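/- Assume hypotheses (Ha) and (G). Then there exist constants ρ > 0 and λ_c < 0 such that for every λ < λ_c and every nonempty subset 𝓘 ⊆ {1,…,n} the problem (P_λ) has a positive solution u satisfying sup_{x ∈ I_i^+} u(x) > ρ for every i ∈ 𝓘 and sup_{x ∈ I_i^+} u(x) < ρ for every i ∈ {1,…,n} \ 𝓘. In particular, solutions corresponding to distinct subsets 𝓘 are distinct. -/

import Mathlib

open Set

/-- `u` is a nonnegative solution of problem (P_λ):
`u ∈ C²([0,L])`, `u ≥ 0`, `-u'' = λ u + a u^p` on `(0,L)`, `u(0) = u(L) = 0`. -/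
def IsNonnegSol (L p lam : ℝ) (a u : ℝ → ℝ) : Prop :=
  ∃ u' u'' : ℝ → ℝ,
    (∀ x ∈ Set.Icc (0:ℝ) L, HasDerivWithinAt u (u' x) (Set.Icc (0:ℝ) L) x) ∧
    (∀ x ∈ Set.Icc (0:ℝ) L, HasDerivWithinAt u' (u'' x) (Set.Icc (0:ℝ) L) x) ∧
    ContinuousOn u'' (Set.Icc (0:ℝ) L) ∧
    (∀ x ∈ Set.Icc (0:ℝ) L, 0 ≤ u x) ∧
    (∀ x ∈ Set.Ioo (0:ℝ) L, -u'' x = lam * u x + a x * u x ^ p) ∧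
    u 0 = 0 ∧ u L = 0

/-- A differentiable function with a right-sided maximum at a critical point has nonpositive
second derivative there. -/
lemma snd_deriv_nonpos_of_right_max {u v : ℝ → ℝ} {w x₀ z : ℝ} (hz : x₀ < z)
    (hu : ∀ x ∈ Icc x₀ z, HasDerivAt u (v x) x) (hv : HasDerivAt v w x₀) (h₀ : v x₀ = 0)
    (hmax : ∀ x ∈ Icc x₀ z, u x ≤ u x₀) : w ≤ 0 := by
  by_contra! hw
  have h1 := (hasDerivAt_iff_tendsto_slope.1 hv).eventually (lt_mem_nhds hw)
  have h2 : ∀ᶠ x in nhdsWithin x₀ (Ioi x₀), 0 < slope v x₀ x :=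
    h1.filter_mono (nhdsWithin_mono _ fun x hx => ne_of_gt hx)
  obtain ⟨b, hb, hb'⟩ := (mem_nhdsGT_iff_exists_Ioo_subset (a := x₀)).1 h2
  have hb : x₀ < b := hb
  have hx : x₀ < min z b := lt_min hz hb
  obtain ⟨c, hc, hc'⟩ := exists_hasDerivAt_eq_slope u v hx
    (fun x hx => (hu x ⟨hx.1, hx.2.trans (min_le_left _ _)⟩).continuousAt.continuousWithinAt)
    (fun x hx => hu x ⟨hx.1.le, hx.2.le.trans (min_le_left _ _)⟩)
  have h3 : 0 < slope v x₀ c := hb' ⟨hc.1, hc.2.trans_le (min_le_right _ _)⟩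
  rw [slope_def_field, h₀, sub_zero] at h3
  have h4 : 0 < v c := (div_pos_iff_of_pos_right (sub_pos.2 hc.1)).1 h3
  have h5 : v c ≤ 0 := by
    rw [hc']
    exact div_nonpos_of_nonpos_of_nonneg
      (sub_nonpos.2 (hmax _ ⟨hx.le, min_le_left _ _⟩)) (sub_nonneg.2 hx.le)
  linarith

lemma deriv_zero_and_snd_deriv_nonpos_of_max {u v w : ℝ → ℝ} {x₀ y z : ℝ} (hx : x₀ ∈ Ioo y z)
    (hu : ∀ x ∈ Icc y z, HasDerivAt u (v x) x) (hv : ∀ x ∈ Icc y z, HasDerivAt v (w x) x)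
    (hmax : ∀ x ∈ Icc y z, u x ≤ u x₀) : v x₀ = 0 ∧ w x₀ ≤ 0 := by
  have h0 : v x₀ = 0 := by
    refine IsLocalMax.hasDerivAt_eq_zero ?_ (hu x₀ ⟨hx.1.le, hx.2.le⟩)
    filter_upwards [Icc_mem_nhds hx.1 hx.2] with x hx' using hmax x hx'
  exact ⟨h0, snd_deriv_nonpos_of_right_max hx.2 (fun x h => hu x ⟨hx.1.le.trans h.1, h.2⟩)
    (hv x₀ ⟨hx.1.le, hx.2.le⟩) h0 (fun x h => hmax x ⟨hx.1.le.trans h.1, h.2⟩)⟩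

lemma exists_max_Icc {u : ℝ → ℝ} {y z : ℝ} (hyz : y ≤ z) (hu : ContinuousOn u (Icc y z)) :
    ∃ x₀ ∈ Icc y z, ∀ x ∈ Icc y z, u x ≤ u x₀ :=
  isCompact_Icc.exists_isMaxOn (nonempty_Icc.2 hyz) hu

/-- Maximum principle: a function that is strictly concave where it is negative and nonnegative at
the end points is nonnegative. -/
lemma nonneg_of_snd_deriv_neg {u v w : ℝ → ℝ} {y z : ℝ}
    (hu : ∀ x ∈ Icc y z, HasDerivAt u (v x) x) (hv : ∀ x ∈ Icc y z, HasDerivAt v (w x) x)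
    (hw : ∀ x ∈ Icc y z, u x < 0 → w x < 0) (hy : 0 ≤ u y) (hz : 0 ≤ u z) :
    ∀ x ∈ Icc y z, 0 ≤ u x := by
  intro x hx
  obtain ⟨x₀, h₀, hmin⟩ := exists_max_Icc (u := fun x => -u x) (hx.1.trans hx.2)
    (fun x hx => (hu x hx).neg.continuousAt.continuousWithinAt)
  by_contra! hneg
  have h1 : u x₀ < 0 := by have := hmin x hx; linarith
  have hy' : y ≠ x₀ := by rintro rfl; linarith
  have hz' : x₀ ≠ z := by rintro rfl; linarith
  have := (deriv_zero_and_snd_deriv_nonpos_of_max (u := fun x => -u x) (v := fun x => -v x)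
    (w := fun x => -w x) ⟨lt_of_le_of_ne h₀.1 hy', lt_of_le_of_ne h₀.2 hz'⟩
    (fun x hx => (hu x hx).neg) (fun x hx => (hv x hx).neg) hmin).2
  have := hw x₀ h₀ h1
  linarith

lemma antitoneOn_Icc_of_hasDerivAt {u v : ℝ → ℝ} {y z : ℝ}
    (hu : ∀ x ∈ Icc y z, HasDerivAt u (v x) x) (hv : ∀ x ∈ Icc y z, v x ≤ 0) :
    AntitoneOn u (Icc y z) :=
  antitoneOn_of_hasDerivWithinAt_nonpos (convex_Icc y z)
    (fun x hx => (hu x hx).continuousAt.continuousWithinAt)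
    (fun x hx => (hu x (interior_subset hx)).hasDerivWithinAt)
    (fun x hx => hv x (interior_subset hx))

/-- Second order Taylor upper bounds. -/
lemma taylor_le {u v w : ℝ → ℝ} {y z C : ℝ}
    (hu : ∀ x ∈ Icc y z, HasDerivAt u (v x) x) (hv : ∀ x ∈ Icc y z, HasDerivAt v (w x) x)
    (hw : ∀ x ∈ Icc y z, w x ≤ C) :
    ∀ x ∈ Icc y z, v x ≤ v y + C * (x - y) ∧ u x ≤ u y + v y * (x - y) + C * (x - y) ^ 2 / 2 := by
  have h1 : ∀ x ∈ Icc y z, v x ≤ v y + C * (x - y) := by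
    intro x hx
    have := antitoneOn_Icc_of_hasDerivAt (u := fun x => v x - C * (x - y)) (v := fun x => w x - C)
      (fun x hx => ((hv x hx).sub (((hasDerivAt_id x).sub_const y).const_mul C)).congr_deriv
        (by simp))
      (fun x hx => by linarith [hw x hx]) ⟨le_rfl, hx.1.trans hx.2⟩ hx hx.1
    simp only [sub_self, mul_zero, sub_zero] at this
    linarith
  intro x hx
  refine ⟨h1 x hx, ?_⟩
  have := antitoneOn_Icc_of_hasDerivAt
      (u := fun x => u x - v y * (x - y) - C / 2 * (x - y) ^ 2)
      (v := fun x => v x - v y - C * (x - y))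
      (fun x hx => by
        have h2 := (((hasDerivAt_id x).sub_const y).pow 2).const_mul (C / 2)
        have h3 := ((hasDerivAt_id x).sub_const y).const_mul (v y)
        refine (((hu x hx).sub h3).sub h2).congr_deriv ?_
        simp; ring)
      (fun x hx => by linarith [h1 x hx]) ⟨le_rfl, hx.1.trans hx.2⟩ hx hx.1
  simp only [sub_self, mul_zero, sub_zero] at this
  nlinarith

/-- Second order Taylor lower bounds. -/
lemma le_taylor {u v w : ℝ → ℝ} {y z C : ℝ}
    (hu : ∀ x ∈ Icc y z, HasDerivAt u (v x) x) (hv : ∀ x ∈ Icc y z, HasDerivAt v (w x) x)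
    (hw : ∀ x ∈ Icc y z, C ≤ w x) :
    ∀ x ∈ Icc y z, v y + C * (x - y) ≤ v x ∧ u y + v y * (x - y) + C * (x - y) ^ 2 / 2 ≤ u x := by
  intro x hx
  have := taylor_le (u := fun x => -u x) (v := fun x => -v x) (w := fun x => -w x) (C := -C)
    (fun x hx => (hu x hx).neg) (fun x hx => (hv x hx).neg)
    (fun x hx => by linarith [hw x hx]) x hx
  constructor <;> linarith [this.1, this.2]

/-- First time a continuous function reaches a level. -/
lemma exists_first_hit {f : ℝ → ℝ} {a b c : ℝ} (hab : a ≤ b) (hf : ContinuousOn f (Icc a b))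
    (ha : f a ≤ c) (hb : c ≤ f b) :
    ∃ t ∈ Icc a b, f t = c ∧ ∀ s ∈ Icc a t, f s ≤ c := by
  have hK : IsCompact (Icc a b ∩ f ⁻¹' Ici c) :=
    isCompact_Icc.of_isClosed_subset (hf.preimage_isClosed_of_isClosed isClosed_Icc isClosed_Ici)
      inter_subset_left
  obtain ⟨t, ⟨ht, htc⟩, hmin⟩ := hK.exists_isLeast ⟨b, ⟨hab, le_rfl⟩, hb⟩
  have htc : c ≤ f t := htc
  have key : f t = c := by
    obtain ⟨s, hs, hsc⟩ := intermediate_value_Icc ht.1 (hf.mono (Icc_subset_Icc_right ht.2))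
      ⟨ha, htc⟩
    have : t ≤ s := hmin ⟨⟨hs.1, hs.2.trans ht.2⟩, hsc.ge⟩
    rw [← hsc, le_antisymm this hs.2]
  refine ⟨t, ht, key, fun s hs => ?_⟩
  by_contra! hcs
  have : t ≤ s := hmin ⟨⟨hs.1, hs.2.trans ht.2⟩, hcs.le⟩
  rw [le_antisymm hs.2 this, key] at hcs
  exact lt_irrefl _ hcs

/-- Last time a continuous function is at a level. -/
lemma exists_last_hit {f : ℝ → ℝ} {a b c : ℝ} (hab : a ≤ b) (hf : ContinuousOn f (Icc a b))
    (ha : f a ≤ c) (hb : c ≤ f b) :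
    ∃ t ∈ Icc a b, f t = c ∧ ∀ s ∈ Icc t b, c ≤ f s := by
  obtain ⟨t, ht, htc, h⟩ := exists_first_hit (f := fun x => -f (-x)) (a := -b) (b := -a) (c := -c)
    (by linarith)
    ((hf.comp continuous_neg.continuousOn
      (fun x hx => ⟨by linarith [hx.2], by linarith [hx.1]⟩)).neg) (by simpa) (by simpa)
  refine ⟨-t, ⟨by linarith [ht.2], by linarith [ht.1]⟩, by linarith, fun s hs => ?_⟩
  have := h (-s) ⟨by linarith [hs.2], by linarith [hs.1]⟩
  simp only [neg_neg] at this
  linarith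

/-- A function that starts positive and nondecreasing, and is convex as long as it is positive,
stays nondecreasing. -/
lemma monotone_of_convex_while_pos {u v w : ℝ → ℝ} {y z : ℝ}
    (hu : ∀ x ∈ Icc y z, HasDerivAt u (v x) x) (hv : ∀ x ∈ Icc y z, HasDerivAt v (w x) x)
    (hw : ∀ x ∈ Icc y z, 0 ≤ u x → 0 ≤ w x) (huy : 0 < u y) (hvy : 0 ≤ v y) :
    ∀ x ∈ Icc y z, 0 ≤ v x ∧ u y ≤ u x := by
  have main : ∀ x ∈ Icc y z, (∀ s ∈ Icc y x, 0 ≤ u s) → 0 ≤ v x ∧ u y ≤ u x := by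
    intro x hx h
    have hsub : ∀ s ∈ Icc y x, s ∈ Icc y z := fun s hs => ⟨hs.1, hs.2.trans hx.2⟩
    have := le_taylor (C := 0) (fun s hs => hu s (hsub s hs)) (fun s hs => hv s (hsub s hs))
      (fun s hs => hw s (hsub s hs) (h s hs)) x ⟨hx.1, le_rfl⟩
    refine ⟨by linarith [this.1], ?_⟩
    have h2 := mul_nonneg hvy (sub_nonneg.2 hx.1)
    linarith [this.2]
  intro x hx
  refine main x hx fun s hs => ?_
  by_contra! hneg
  obtain ⟨t, ht, htc, hlt⟩ := exists_first_hit (f := fun x => -u x) (c := 0) hs.1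
    (fun r hr => (hu r ⟨hr.1, hr.2.trans (hs.2.trans hx.2)⟩).neg.continuousAt.continuousWithinAt)
    (by linarith) (by linarith)
  have := (main t ⟨ht.1, ht.2.trans (hs.2.trans hx.2)⟩
    (fun r hr => by linarith [hlt r hr])).2
  linarith

/-- Keller–Osserman type growth: a solution of `u'' ≥ α u ^ p` starting at a sufficiently large
height with nonnegative slope exceeds every bound within a given distance `η`. -/
lemma exists_keller_osserman {p α η : ℝ} (hp : 1 < p) (hα : 0 < α) (hη : 0 < η) :
    ∀ᶠ ρ in Filter.atTop, ∀ M : ℝ, ∀ u v w : ℝ → ℝ, ∀ y : ℝ,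
      (∀ x ∈ Icc y (y + η), HasDerivAt u (v x) x) →
      (∀ x ∈ Icc y (y + η), HasDerivAt v (w x) x) →
      (∀ x ∈ Icc y (y + η), 0 ≤ u x → u x ≤ M → α * u x ^ p ≤ w x) →
      (∀ x ∈ Icc y (y + η), 0 ≤ u x → 0 ≤ w x) →
      u y = ρ → 0 ≤ v y → ∃ x ∈ Icc y (y + η), M ≤ u x := by
  set q : ℝ := 2 ^ (-(p - 1) / 2) with hq
  have hq0 : 0 < q := by positivity
  have hq1 : q < 1 := Real.rpow_lt_one_of_one_lt_of_neg (by norm_num) (by linarith)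
  have hq2 : q ^ 2 * 2 ^ (p - 1) = 1 := by
    rw [← Real.rpow_natCast, hq, ← Real.rpow_mul (by norm_num), ← Real.rpow_add (by norm_num)]
    norm_num
  have hlarge : ∀ᶠ ρ : ℝ in Filter.atTop, 2 / (η ^ 2 * (1 - q) ^ 2 * α) ≤ ρ ^ (p - 1) :=
    (tendsto_rpow_atTop (by linarith)).eventually_ge_atTop _
  have hpos : 0 < η ^ 2 * (1 - q) ^ 2 * α := by
    have := sub_pos.2 hq1
    positivity
  filter_upwards [hlarge, Filter.eventually_gt_atTop 0] with ρ hρ hρ0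
  rw [div_le_iff₀ hpos] at hρ
  intro M u v w y hu hv hKO hconv huy hvy
  by_contra! hM
  have hmono := monotone_of_convex_while_pos hu hv hconv (huy ▸ hρ0) hvy
  have hin : ∀ k : ℕ, y + η * (1 - q ^ k) ∈ Icc y (y + η) := fun k => by
    have h1 : q ^ k ≤ 1 := pow_le_one₀ hq0.le hq1.le
    have h2 : 0 < q ^ k := by positivity
    constructor <;> nlinarith
  have key : ∀ k : ℕ, 2 ^ k * ρ ≤ u (y + η * (1 - q ^ k)) := by
    intro k
    induction k with
    | zero => simp [huy]
    | succ k ih =>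
      have hk := hin k
      have hk1 := hin (k + 1)
      set x := y + η * (1 - q ^ k) with hx
      set x' := y + η * (1 - q ^ (k + 1)) with hx'
      have hd : x' - x = η * (1 - q) * q ^ k := by rw [hx, hx']; ring
      have hd0 : 0 ≤ x' - x := by
        rw [hd]; have := sub_pos.2 hq1; positivity
      have hsub : ∀ s ∈ Icc x x', s ∈ Icc y (y + η) :=
        fun s hs => ⟨hk.1.trans hs.1, hs.2.trans hk1.2⟩
      have hR : 0 < 2 ^ k * ρ := by positivity
      have hmono' := monotone_of_convex_while_pos (fun s hs => hu s (hsub s hs))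
        (fun s hs => hv s (hsub s hs)) (fun s hs => hconv s (hsub s hs))
        (hR.trans_le ih) (hmono x hk).1
      have hT := (le_taylor (C := α * (2 ^ k * ρ) ^ p) (fun s hs => hu s (hsub s hs))
        (fun s hs => hv s (hsub s hs)) (fun s hs => by
          have h1 := (hmono' s hs).2
          have h2 : (2 ^ k * ρ) ^ p ≤ u s ^ p :=
            Real.rpow_le_rpow hR.le (ih.trans h1) (by linarith)
          exact (mul_le_mul_of_nonneg_left h2 hα.le).trans
            (hKO s (hsub s hs) (by linarith) (hM s (hsub s hs)).le))
        x' ⟨by linarith, le_rfl⟩).2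
      have h3 : 2 ^ k * ρ ≤ α * (2 ^ k * ρ) ^ p * (x' - x) ^ 2 / 2 := by
        have e1 : (2 ^ k * ρ : ℝ) ^ p = 2 ^ k * ρ * ((2 ^ (p - 1)) ^ k * ρ ^ (p - 1)) := by
          have : (2 ^ k * ρ : ℝ) ^ p = (2 ^ k * ρ) ^ (1 + (p - 1)) := by ring_nf
          rw [this, Real.rpow_add hR, Real.rpow_one, Real.mul_rpow (by positivity) hρ0.le,
            ← Real.rpow_natCast 2 k, ← Real.rpow_mul (by norm_num), mul_comm (k : ℝ),
            Real.rpow_mul (by norm_num), Real.rpow_natCast, Real.rpow_natCast]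
        have e2 : (q ^ k) ^ 2 * (2 ^ (p - 1)) ^ k = 1 := by
          rw [← pow_mul, mul_comm k 2, pow_mul, ← mul_pow, hq2, one_pow]
        have e3 : α * (2 ^ k * ρ) ^ p * (x' - x) ^ 2 / 2
            = 2 ^ k * ρ * ((ρ ^ (p - 1) * (η ^ 2 * (1 - q) ^ 2 * α)) / 2) := by
          rw [e1, hd]
          linear_combination (2 ^ k * ρ * ρ ^ (p - 1) * η ^ 2 * (1 - q) ^ 2 * α / 2) * e2
        rw [e3]
        exact le_mul_of_one_le_right hR.le (by linarith)
      have h4 := mul_nonneg (hmono x hk).1 hd0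
      rw [pow_succ]
      linarith
  obtain ⟨k, hk⟩ := pow_unbounded_of_one_lt (M / ρ) (one_lt_two (α := ℝ))
  rw [div_lt_iff₀ hρ0] at hk
  linarith [key k, hM _ (hin k)]

/-- A bounded nonnegative function that stays below `M`, starts at height `M` with nonpositive
slope and is very concave on `[y + d / 2, y + d]` as long as it exceeds `M / 2` cannot exist on a
long enough interval. -/
lemma no_descent {u v w : ℝ → ℝ} {y d M μ N : ℝ} (hd : 0 < d) (hM : 0 < M)
    (hμd : 16 * d ^ 2 * μ ≤ 1) (hN : 5 ≤ N * d ^ 2)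
    (hu : ∀ x ∈ Icc y (y + 5 * d), HasDerivAt u (v x) x)
    (hv : ∀ x ∈ Icc y (y + 5 * d), HasDerivAt v (w x) x)
    (hw : ∀ x ∈ Icc y (y + 5 * d), w x ≤ μ * M)
    (hN' : ∀ x ∈ Icc (y + d / 2) (y + d), M / 2 ≤ u x → w x ≤ -(N * M))
    (hb : ∀ x ∈ Icc y (y + 5 * d), 0 ≤ u x ∧ u x ≤ M)
    (huy : u y = M) (hvy : v y ≤ 0) : False := by
  by_cases h : ∀ x ∈ Icc y (y + d), M / 2 ≤ u x
  · have hs1 : ∀ x ∈ Icc y (y + d / 2), x ∈ Icc y (y + 5 * d) :=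
      fun x hx => ⟨hx.1, by linarith [hx.2]⟩
    have hs2 : ∀ x ∈ Icc (y + d / 2) (y + d), x ∈ Icc y (y + 5 * d) :=
      fun x hx => ⟨by linarith [hx.1], by linarith [hx.2]⟩
    have h1 := (taylor_le (C := μ * M) (fun x hx => hu x (hs1 x hx)) (fun x hx => hv x (hs1 x hx))
      (fun x hx => hw x (hs1 x hx)) (y + d / 2) ⟨by linarith, le_rfl⟩).1
    have h2 := (taylor_le (C := -(N * M)) (fun x hx => hu x (hs2 x hx))
      (fun x hx => hv x (hs2 x hx)) (fun x hx => hN' x hx (h x ⟨by linarith [hx.1], hx.2⟩))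
      (y + d) ⟨by linarith, le_rfl⟩).2
    have h3 := (hb (y + d / 2) ⟨by linarith, by linarith⟩).2
    have h4 := h (y + d) ⟨by linarith, le_rfl⟩
    have e1 : y + d / 2 - y = d / 2 := by ring
    have e2 : y + d - (y + d / 2) = d / 2 := by ring
    rw [e1] at h1
    rw [e2] at h2
    have h5 : v (y + d / 2) * (d / 2) ≤ μ * M * (d / 2) * (d / 2) :=
      mul_le_mul_of_nonneg_right (by linarith) (by linarith)
    have h6 : 5 * M ≤ N * d ^ 2 * M := mul_le_mul_of_nonneg_right hN hM.le
    have h7 : 16 * d ^ 2 * μ * M ≤ 1 * M := mul_le_mul_of_nonneg_right hμd hM.le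
    nlinarith
  · push Not at h
    obtain ⟨x₁, hx₁, hlt⟩ := h
    have hne : y < x₁ := lt_of_le_of_ne hx₁.1 (by rintro rfl; linarith)
    obtain ⟨z, hz, hz'⟩ := exists_hasDerivAt_eq_slope u v hne
      (fun x hx => (hu x ⟨hx.1, by linarith [hx.2, hx₁.2]⟩).continuousAt.continuousWithinAt)
      (fun x hx => hu x ⟨hx.1.le, by linarith [hx.2, hx₁.2]⟩)
    have hs : ∀ x ∈ Icc z (z + 4 * d), x ∈ Icc y (y + 5 * d) :=
      fun x hx => ⟨by linarith [hx.1, hz.1], by linarith [hx.2, hz.2, hx₁.2]⟩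
    have h1 := (taylor_le (C := μ * M) (fun x hx => hu x (hs x hx)) (fun x hx => hv x (hs x hx))
      (fun x hx => hw x (hs x hx)) (z + 4 * d) ⟨by linarith, le_rfl⟩).2
    have h2 := (hb (z + 4 * d) (hs _ ⟨by linarith, le_rfl⟩)).1
    have h3 := (hb z (hs _ ⟨le_rfl, by linarith⟩)).2
    have h4 : v z * d ≤ -(M / 2) := by
      have h5 : v z * (x₁ - y) = u x₁ - M := by
        rw [hz', huy]; field_simp [(sub_pos.2 hne).ne']
      have h6 : v z ≤ 0 := by
        by_contra! h7
        have := mul_pos h7 (sub_pos.2 hne)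
        linarith
      nlinarith [hx₁.2]
    have e1 : z + 4 * d - z = 4 * d := by ring
    rw [e1] at h1
    have h7 : 16 * d ^ 2 * μ * M ≤ 1 * M := mul_le_mul_of_nonneg_right hμd hM.le
    nlinarith

/-- For large `M`, a nonnegative solution of `u'' = μ u - a u ^ p` on an interval where `a > 0`
cannot have maximum exactly `M`. -/
lemma exists_no_large_max {p μ σ τ : ℝ} {a : ℝ → ℝ} (hp : 1 < p) (hμ : 0 < μ) (hστ : σ < τ)
    (ha : ContinuousOn a (Icc σ τ)) (hpos : ∀ x ∈ Ioo σ τ, 0 < a x) :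
    ∀ᶠ M in Filter.atTop, ∀ u v w : ℝ → ℝ,
      (∀ x ∈ Icc σ τ, HasDerivAt u (v x) x) → (∀ x ∈ Icc σ τ, HasDerivAt v (w x) x) →
      (∀ x ∈ Icc σ τ, 0 ≤ u x ∧ u x ≤ M) →
      (∀ x ∈ Icc σ τ, w x = μ * u x - a x * u x ^ p) →
      ∀ y ∈ Icc σ τ, u y = M → (y < τ → v y ≤ 0) → (σ < y → 0 ≤ v y) → False := by
  obtain ⟨d, hd, hμd, hdl⟩ : ∃ d : ℝ, 0 < d ∧ 16 * d ^ 2 * μ ≤ 1 ∧ 10 * d ≤ τ - σ := by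
    refine ⟨min ((τ - σ) / 10) (Real.sqrt (1 / (16 * μ))), ?_, ?_, ?_⟩
    · exact lt_min (by linarith) (by positivity)
    · have h1 : (min ((τ - σ) / 10) (Real.sqrt (1 / (16 * μ)))) ^ 2 ≤ 1 / (16 * μ) := by
        rw [← Real.sq_sqrt (show 0 ≤ 1 / (16 * μ) by positivity)]
        have : 0 ≤ min ((τ - σ) / 10) (Real.sqrt (1 / (16 * μ))) :=
          le_min (by linarith) (by positivity)
        gcongr
        rw [Real.sq_sqrt (by positivity)]
        exact min_le_right _ _
      calc _ ≤ 16 * (1 / (16 * μ)) * μ := by gcongr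
        _ = 1 := by field_simp
    · linarith [min_le_left ((τ - σ) / 10) (Real.sqrt (1 / (16 * μ)))]
  have hsub : Icc (σ + d / 2) (τ - d / 2) ⊆ Ioo σ τ :=
    fun x hx => ⟨by linarith [hx.1], by linarith [hx.2]⟩
  obtain ⟨x₀, hx₀, hmin⟩ := isCompact_Icc.exists_isMinOn
    (nonempty_Icc.2 (by linarith : σ + d / 2 ≤ τ - d / 2))
    (ha.mono (hsub.trans Ioo_subset_Icc_self))
  have hα : 0 < a x₀ := hpos x₀ (hsub hx₀)
  have hlim : Filter.Tendsto (fun M : ℝ => (a x₀ * (M / 2) ^ (p - 1) - μ) / 2)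
      Filter.atTop Filter.atTop := by
    refine Filter.Tendsto.atTop_div_const (by norm_num) ?_
    refine Filter.tendsto_atTop_add_const_right _ _ (Filter.Tendsto.const_mul_atTop hα ?_)
    exact (tendsto_rpow_atTop (by linarith)).comp
      (Filter.tendsto_id.atTop_div_const (by norm_num))
  filter_upwards [hlim.eventually_ge_atTop (5 / d ^ 2), Filter.eventually_gt_atTop 0]
    with M hMN hM
  intro u v w hu hv hb hw y hy huy hvr hvl
  have hN : 5 ≤ (a x₀ * (M / 2) ^ (p - 1) - μ) / 2 * d ^ 2 := by
    rwa [div_le_iff₀ (by positivity)] at hMN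
  have hN0 : 0 < a x₀ * (M / 2) ^ (p - 1) - μ := by
    by_contra! hneg
    have : (a x₀ * (M / 2) ^ (p - 1) - μ) / 2 * d ^ 2 ≤ 0 :=
      mul_nonpos_of_nonpos_of_nonneg (by linarith) (by positivity)
    linarith
  have hapos : ∀ x ∈ Icc σ τ, 0 ≤ a x := by
    have : Icc σ τ ⊆ closure (Ioo σ τ) := (closure_Ioo hστ.ne).ge
    intro x hx
    have hne : (nhdsWithin x (Ioo σ τ)).NeBot := mem_closure_iff_nhdsWithin_neBot.1 (this hx)
    refine ge_of_tendsto ((ha x hx).mono_left (nhdsWithin_mono _ Ioo_subset_Icc_self)) ?_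
    filter_upwards [self_mem_nhdsWithin] with z hz using (hpos z hz).le
  have hwM : ∀ x ∈ Icc σ τ, w x ≤ μ * M := fun x hx => by
    have h1 := mul_nonneg (hapos x hx) (Real.rpow_nonneg (hb x hx).1 p)
    have h2 := mul_le_mul_of_nonneg_left (hb x hx).2 hμ.le
    linarith [hw x hx]
  have hwN : ∀ x ∈ Icc (σ + d / 2) (τ - d / 2), M / 2 ≤ u x →
      w x ≤ -((a x₀ * (M / 2) ^ (p - 1) - μ) / 2 * M) := by
    intro x hx hMu
    have hx' := Ioo_subset_Icc_self (hsub hx)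
    have h0 : 0 < u x := by linarith
    have e1 : u x ^ p = u x * u x ^ (p - 1) := by
      nth_rewrite 2 [← Real.rpow_one (u x)]
      rw [← Real.rpow_add h0]; ring_nf
    have h1 : (M / 2) ^ (p - 1) ≤ u x ^ (p - 1) :=
      Real.rpow_le_rpow (by linarith) hMu (by linarith)
    have h2 : a x₀ * (M / 2) ^ (p - 1) ≤ a x * u x ^ (p - 1) :=
      mul_le_mul (hmin hx) h1 (by positivity) (hapos x hx')
    have h3 : (a x₀ * (M / 2) ^ (p - 1) - μ) * (M / 2) ≤ (a x * u x ^ (p - 1) - μ) * u x :=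
      mul_le_mul (by linarith) hMu (by linarith) (by linarith)
    rw [hw x hx', e1]
    linarith
  rcases le_total y ((σ + τ) / 2) with hmid | hmid
  · have hs : ∀ x ∈ Icc y (y + 5 * d), x ∈ Icc σ τ :=
      fun x hx => ⟨hy.1.trans hx.1, by linarith [hx.2]⟩
    exact no_descent hd hM hμd hN (fun x hx => hu x (hs x hx)) (fun x hx => hv x (hs x hx))
      (fun x hx => hwM x (hs x hx))
      (fun x hx => hwN x ⟨by linarith [hx.1, hy.1], by linarith [hx.2]⟩)
      (fun x hx => hb x (hs x hx)) huy (hvr (by linarith))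
  · have hs : ∀ x ∈ Icc y (y + 5 * d), 2 * y - x ∈ Icc σ τ :=
      fun x hx => ⟨by linarith [hx.2], by linarith [hx.1, hy.2]⟩
    have hy2 : 2 * y - y = y := by ring
    exact no_descent (u := fun x => u (2 * y - x)) (v := fun x => -v (2 * y - x))
      (w := fun x => w (2 * y - x)) hd hM hμd hN
      (fun x hx => by
        have := (hu _ (hs x hx)).comp x ((hasDerivAt_id x).const_sub (2 * y))
        simpa [Function.comp_def] using this)
      (fun x hx => by
        have := ((hv _ (hs x hx)).comp x ((hasDerivAt_id x).const_sub (2 * y))).neg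
        exact this.congr_deriv (by simp))
      (fun x hx => hwM _ (hs x hx))
      (fun x hx => hwN _ ⟨by linarith [hx.2], by linarith [hx.1, hy.2]⟩)
      (fun x hx => hb _ (hs x hx)) (by simpa [hy2] using huy)
      (by simpa [hy2] using hvl (by linarith))

/-- The flow of `u'' = f x u` for a bounded Lipschitz right-hand side, started at `x = 0` from
`u = 0` with slope `s ∈ [0, S]`. -/
lemma exists_shooting_flow {L S : ℝ} {C K : NNReal} (hL : 0 < L) (hS : 0 ≤ S) {f : ℝ → ℝ → ℝ}
    (hfc : ∀ u, Continuous fun x => f x u) (hfb : ∀ x u, |f x u| ≤ C)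
    (hfl : ∀ x, LipschitzWith K (f x)) (hf0 : ∀ x, f x 0 = 0) :
    ∃ U V : ℝ → ℝ → ℝ,
      (∀ s ∈ Icc 0 S, ∀ x ∈ Icc 0 L, HasDerivAt (U s) (V s x) x) ∧
      (∀ s ∈ Icc 0 S, ∀ x ∈ Icc 0 L, HasDerivAt (V s) (f x (U s x)) x) ∧
      (∀ s ∈ Icc 0 S, U s 0 = 0 ∧ V s 0 = s) ∧
      (∀ s ∈ Icc 0 S, ∀ x₀ ∈ Icc 0 L, U s x₀ = 0 → V s x₀ = 0 → ∀ x ∈ Icc 0 L, U s x = 0) ∧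
      ∃ g : ℝ → ℝ → ℝ, Continuous ↿g ∧ ∀ s ∈ Icc 0 S, ∀ x ∈ Icc 0 L, g s x = U s x := by
  obtain ⟨S, rfl⟩ : ∃ S' : NNReal, S = S' := ⟨⟨S, hS⟩, rfl⟩
  obtain ⟨T, hT⟩ : ∃ T : NNReal, L + 1 = T := ⟨⟨L + 1, by linarith⟩, rfl⟩
  have hT0 : (0 : ℝ) < T := by linarith
  set B : NNReal := S + C * T with hB
  set F : ℝ → ℝ × ℝ → ℝ × ℝ := fun x z => (max (-B) (min z.2 B), f x z.1) with hF
  have hFl : ∀ x, LipschitzWith (max 1 K) (F x) := by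
    intro x
    have h1 : LipschitzWith 1 fun z : ℝ × ℝ => max (-(B : ℝ)) (min z.2 B) :=
      (LipschitzWith.prod_snd.min_const _).const_max _
    have h2 : LipschitzWith K fun z : ℝ × ℝ => f x z.1 := by
      simpa [Function.comp_def] using (hfl x).comp (LipschitzWith.prod_fst (α := ℝ) (β := ℝ))
    exact h1.prodMk h2
  have h0 : (0 : ℝ) ∈ Icc (-1) (T : ℝ) := ⟨by norm_num, hT0.le⟩
  have hPL : IsPicardLindelof F (⟨0, h0⟩ : Icc (-1 : ℝ) T) (0 : ℝ × ℝ)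
      (S + (B + C) * T) S (B + C) (max 1 K) := by
    refine ⟨fun x _ => (hFl x).lipschitzOnWith, fun z _ => ?_, fun x _ z _ => ?_, ?_⟩
    · exact (continuous_const.prodMk (hfc z.1)).continuousOn
    · rw [Prod.norm_def]
      refine max_le ?_ ?_
      · refine (abs_le.2 ⟨le_max_left _ _, max_le ?_ (min_le_right _ _)⟩).trans ?_
        · linarith [B.2]
        · push_cast; linarith [C.2]
      · refine (hfb x z.1).trans ?_
        push_cast; linarith [B.2]
    · have : max ((T : ℝ) - 0) (0 - -1) = T := by
        rw [sub_zero]; exact max_eq_left (by linarith)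
      simp only [this]
      push_cast; linarith
  obtain ⟨α, hα, hαc⟩ := hPL.exists_forall_mem_closedBall_eq_hasDerivWithinAt_continuousOn
  have hmem : ∀ s ∈ Icc (0 : ℝ) S, ((0 : ℝ), s) ∈ Metric.closedBall (0 : ℝ × ℝ) S := by
    intro s hs
    simp only [Metric.mem_closedBall, dist_zero_right, Prod.norm_def, norm_zero]
    exact max_le S.2 (abs_le.2 ⟨by linarith [hs.1, S.2], hs.2⟩)
  have hd : ∀ s ∈ Icc (0 : ℝ) S, ∀ x ∈ Ioo (-1 : ℝ) T,
      HasDerivAt (fun x => α ((0, s), x)) (F x (α ((0, s), x))) x := fun s hs x hx =>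
    ((hα _ (hmem s hs)).2 x ⟨hx.1.le, hx.2.le⟩).hasDerivAt (Icc_mem_nhds hx.1 hx.2)
  have hsub : ∀ x ∈ Icc (0 : ℝ) L, x ∈ Ioo (-1 : ℝ) T :=
    fun x hx => ⟨by linarith [hx.1], by linarith [hx.2]⟩
  have hdV : ∀ s ∈ Icc (0 : ℝ) S, ∀ x ∈ Icc (0 : ℝ) L,
      HasDerivAt (fun x => (α ((0, s), x)).2) (f x (α ((0, s), x)).1) x :=
    fun s hs x hx => (hd s hs x (hsub x hx)).snd
  have hinit : ∀ s ∈ Icc (0 : ℝ) S, α ((0, s), 0) = (0, s) := fun s hs => (hα _ (hmem s hs)).1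
  have hVb : ∀ s ∈ Icc (0 : ℝ) S, ∀ x ∈ Icc (0 : ℝ) L, |(α ((0, s), x)).2| ≤ B := by
    intro s hs x hx
    have h1 := (convex_Icc 0 L).norm_image_sub_le_of_norm_hasDerivWithin_le
      (f := fun x => (α ((0, s), x)).2)
      (fun y hy => (hdV s hs y hy).hasDerivWithinAt) (fun y _ => hfb y _)
      ⟨le_rfl, hL.le⟩ hx
    simp only [hinit s hs, Real.norm_eq_abs, sub_zero] at h1
    rw [abs_of_nonneg hx.1] at h1
    have h2 : (C : ℝ) * x ≤ C * T := mul_le_mul_of_nonneg_left (by linarith [hx.2]) C.2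
    have h3 := abs_le.1 h1
    rw [hB]
    push_cast
    exact abs_le.2 ⟨by linarith [h3.1, hs.1], by linarith [h3.2, hs.2]⟩
  refine ⟨fun s x => (α ((0, s), x)).1, fun s x => (α ((0, s), x)).2, ?_, hdV, ?_, ?_, ?_⟩
  · intro s hs x hx
    have h1 := abs_le.1 (hVb s hs x hx)
    have h2 : HasDerivAt (fun x => (α ((0, s), x)).1) (F x (α ((0, s), x))).1 x :=
      (hd s hs x (hsub x hx)).fst
    refine h2.congr_deriv ?_
    simp only [hF]
    rw [min_eq_left h1.2, max_eq_right h1.1]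
  · intro s hs
    simp [hinit s hs]
  · intro s hs x₀ hx₀ hU hV x hx
    have := ODE_solution_unique_of_mem_Ioo (v := F) (s := fun _ => univ) (K := max 1 K)
      (g := fun _ => (0 : ℝ × ℝ)) (fun t _ => (hFl t).lipschitzOnWith) (hsub x₀ hx₀)
      (fun t ht => ⟨hd s hs t ht, mem_univ _⟩)
      (fun t _ => ⟨by
        have : F t 0 = 0 := by
          simp [hF, hf0]
        rw [this]
        exact hasDerivAt_const t 0, mem_univ _⟩)
      (Prod.ext hU hV) (hsub x hx)
    simp only [this, Prod.fst_zero]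
  · refine ⟨fun s x => (α ((0, (projIcc 0 (S : ℝ) hS s : ℝ)), (projIcc 0 L hL.le x : ℝ))).1,
      ?_, ?_⟩
    · refine continuous_fst.comp (hαc.comp_continuous ?_ ?_)
      · exact (continuous_const.prodMk (continuous_subtype_val.comp
          (continuous_projIcc.comp continuous_fst))).prodMk
          (continuous_subtype_val.comp (continuous_projIcc.comp continuous_snd))
      · intro z
        refine ⟨hmem _ (Subtype.coe_prop _), ?_⟩
        have := hsub _ (Subtype.coe_prop (projIcc 0 L hL.le z.2))
        exact ⟨this.1.le, this.2.le⟩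
    · intro s hs x hx
      simp only [projIcc_of_mem hS hs, projIcc_of_mem hL.le hx]

/-- The nonlinearity `μ u - a u ^ p`, modified outside `[0, M]` to be bounded and Lipschitz. -/
noncomputable def truncField (μ p M : ℝ) (a : ℝ → ℝ) (x u : ℝ) : ℝ :=
  μ * max (-1) (min u M) - a x * (max 0 (min u M)) ^ p

section truncField

variable {μ p M A : ℝ} {a : ℝ → ℝ}

lemma truncField_zero (hp : 1 < p) (hM : 0 < M) (x : ℝ) : truncField μ p M a x 0 = 0 := by
  simp [truncField, hM.le, Real.zero_rpow (by linarith : p ≠ 0)]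

lemma continuous_truncField (ha : Continuous a) (u : ℝ) :
    Continuous fun x => truncField μ p M a x u := by
  unfold truncField
  fun_prop

lemma abs_truncField_le (hp : 1 < p) (hμ : 0 < μ) (hM : 1 ≤ M) (hA : ∀ x, |a x| ≤ A) (x u : ℝ) :
    |truncField μ p M a x u| ≤ μ * M + A * M ^ p := by
  unfold truncField
  refine (abs_sub _ _).trans (add_le_add ?_ ?_)
  · rw [abs_mul, abs_of_pos hμ]
    refine mul_le_mul_of_nonneg_left (abs_le.2 ⟨?_, ?_⟩) hμ.le
    · exact (neg_le_neg hM).trans (le_max_left _ _)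
    · exact max_le (by linarith) (min_le_right _ _)
  · have h0 : 0 ≤ max 0 (min u M) := le_max_left _ _
    rw [abs_mul, abs_of_nonneg (Real.rpow_nonneg h0 p)]
    refine mul_le_mul (hA x) ?_ (by positivity) ((abs_nonneg _).trans (hA x))
    exact Real.rpow_le_rpow h0 (max_le (by linarith) (min_le_right _ _)) (by linarith)

lemma exists_lipschitzWith_truncField (hp : 1 < p) (hM : 1 ≤ M) (hA : ∀ x, |a x| ≤ A) :
    ∃ K : NNReal, ∀ x, LipschitzWith K (truncField μ p M a x) := by
  have hpow : LipschitzOnWith (p * M ^ (p - 1)).toNNReal (fun r : ℝ => r ^ p) (Icc 0 M) := by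
    refine (convex_Icc 0 M).lipschitzOnWith_of_nnnorm_hasDerivWithin_le
      (fun r _ => (Real.hasDerivAt_rpow_const (Or.inr hp.le)).hasDerivWithinAt) fun r hr => ?_
    rw [← NNReal.coe_le_coe, Real.coe_toNNReal _ (by positivity), coe_nnnorm, norm_mul,
      Real.norm_of_nonneg (by linarith), Real.norm_of_nonneg (Real.rpow_nonneg hr.1 _)]
    exact mul_le_mul_of_nonneg_left
      (Real.rpow_le_rpow hr.1 hr.2 (by linarith)) (by linarith)
  have h1 : LipschitzWith 1 fun u : ℝ => max (-1) (min u M) :=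
    (LipschitzWith.id.min_const _).const_max _
  have h2 : LipschitzWith 1 fun u : ℝ => max 0 (min u M) :=
    (LipschitzWith.id.min_const _).const_max _
  refine ⟨‖μ‖₊ + A.toNNReal * (p * M ^ (p - 1)).toNNReal, fun x => ?_⟩
  refine LipschitzWith.of_dist_le_mul fun u u' => ?_
  have e1 := h1.dist_le_mul u u'
  have e2 := hpow.dist_le_mul (max 0 (min u M))
    ⟨le_max_left _ _, max_le (by linarith) (min_le_right _ _)⟩ (max 0 (min u' M))
    ⟨le_max_left _ _, max_le (by linarith) (min_le_right _ _)⟩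
  have e3 := h2.dist_le_mul u u'
  simp only [Real.dist_eq, NNReal.coe_one, one_mul] at e1 e2 e3 ⊢
  have hA0 : 0 ≤ A := (abs_nonneg _).trans (hA x)
  push_cast
  rw [Real.coe_toNNReal _ hA0, Real.norm_eq_abs]
  unfold truncField
  calc _ = |μ * (max (-1) (min u M) - max (-1) (min u' M))
        - a x * (max 0 (min u M) ^ p - max 0 (min u' M) ^ p)| := by congr 1; ring
    _ ≤ |μ| * |u - u'| + A * (((p * M ^ (p - 1)).toNNReal : ℝ) * |u - u'|) := by
      refine (abs_sub _ _).trans (add_le_add ?_ ?_) <;> rw [abs_mul]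
      · exact mul_le_mul_of_nonneg_left e1 (abs_nonneg _)
      · exact mul_le_mul (hA x) (e2.trans (mul_le_mul_of_nonneg_left e3 NNReal.zero_le_coe))
          (abs_nonneg _) hA0
    _ = _ := by ring

lemma truncField_of_mem {u : ℝ} (hu : 0 ≤ u) (huM : u ≤ M) (x : ℝ) :
    truncField μ p M a x u = μ * u - a x * u ^ p := by
  rw [truncField, min_eq_left huM, max_eq_right hu, max_eq_right (by linarith)]

lemma truncField_neg (hp : 1 < p) (hμ : 0 < μ) (hM : 0 < M) {u : ℝ} (hu : u < 0) (x : ℝ) :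
    truncField μ p M a x u < 0 := by
  rw [truncField, min_eq_left (by linarith), max_eq_left hu.le, Real.zero_rpow (by linarith)]
  have : max (-1) u < 0 := max_lt (by norm_num) hu
  nlinarith

lemma le_truncField_of_nonpos (hM : 0 < M) {u x : ℝ} (hu : 0 ≤ u) (ha : a x ≤ 0) :
    μ * min u M ≤ truncField μ p M a x u := by
  have h0 : 0 ≤ min u M := le_min hu hM.le
  rw [truncField, max_eq_right h0, max_eq_right (by linarith)]
  have := mul_nonpos_of_nonpos_of_nonneg ha (Real.rpow_nonneg h0 p)
  linarith

lemma truncField_pos_of_nonpos (hμ : 0 < μ) (hM : 0 < M) {u x : ℝ} (hu : 0 < u) (ha : a x ≤ 0) :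
    0 < truncField μ p M a x u :=
  (mul_pos hμ (lt_min hu hM)).trans_le (le_truncField_of_nonpos hM hu.le ha)

lemma truncField_pos_of_small (hp : 1 < p) {R : ℝ} (hR : R ≤ M) (hA : ∀ x, |a x| ≤ A)
    (hμ : A * R ^ (p - 1) < μ) {u : ℝ} (hu : 0 < u) (huR : u ≤ R) (x : ℝ) :
    0 < truncField μ p M a x u := by
  rw [truncField_of_mem hu.le (huR.trans hR)]
  have e1 : u ^ p = u ^ (p - 1) * u := by
    nth_rewrite 3 [← Real.rpow_one u]
    rw [← Real.rpow_add hu]; ring_nf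
  have hA0 : 0 ≤ A := (abs_nonneg _).trans (hA x)
  have h1 : a x * u ^ (p - 1) ≤ A * R ^ (p - 1) :=
    mul_le_mul ((le_abs_self _).trans (hA x)) (Real.rpow_le_rpow hu.le huR (by linarith))
      (Real.rpow_nonneg hu.le _) hA0
  rw [e1]
  nlinarith

lemma mul_rpow_le_truncField (hμ : 0 < μ) {α u x : ℝ} (ha : a x ≤ -α) (hu : 0 ≤ u) (huM : u ≤ M) :
    α * u ^ p ≤ truncField μ p M a x u := by
  rw [truncField_of_mem hu huM]
  have := mul_le_mul_of_nonneg_right ha (Real.rpow_nonneg hu p)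
  nlinarith

lemma truncField_nonneg_of_nonpos (hμ : 0 < μ) (hM : 0 < M) {u x : ℝ} (hu : 0 ≤ u)
    (ha : a x ≤ 0) : 0 ≤ truncField μ p M a x u :=
  (mul_nonneg hμ.le (le_min hu hM.le)).trans (le_truncField_of_nonpos hM hu ha)

end truncField

/-- The part of a path on which the terminal value `h` runs from `0` to `r` while the maximum `G`
stays below `r`. -/
lemma exists_subpath_small {h G Q : ℝ → ℝ} {r M : ℝ} (hr : 0 < r) (hrM : r < M)
    (hh : ContinuousOn h (Icc 0 1)) (hG : ContinuousOn G (Icc 0 1))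
    (hhG : ∀ t ∈ Icc (0 : ℝ) 1, h t ≤ G t) (hQG : ∀ t ∈ Icc (0 : ℝ) 1, Q t ≤ G t)
    (h0 : h 0 ≤ 0) (hG0 : G 0 ≤ r) (hQ1 : M ≤ Q 1)
    (hGr : ∀ t ∈ Icc (0 : ℝ) 1, G t = r → h t = r) :
    ∃ e₀ ∈ Icc (0 : ℝ) 1, ∃ e₁ ∈ Icc (0 : ℝ) 1, h e₀ = 0 ∧ h e₁ = r ∧
      ∀ t ∈ uIcc e₀ e₁, 0 ≤ h t ∧ h t ≤ r ∧ G t ≤ r := by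
  obtain ⟨t₁, ht₁, hGt₁, hle⟩ := exists_first_hit zero_le_one hG hG0
    (by linarith [hQG 1 ⟨zero_le_one, le_rfl⟩])
  have hht₁ := hGr t₁ ht₁ hGt₁
  have hsub : Icc 0 t₁ ⊆ Icc (0 : ℝ) 1 := Icc_subset_Icc_right ht₁.2
  obtain ⟨t₀, ht₀, hht₀, hge⟩ := exists_last_hit ht₁.1 (hh.mono hsub) h0
    (hht₁.symm ▸ hr.le)
  refine ⟨t₀, hsub ht₀, t₁, ht₁, hht₀, hht₁, fun t ht => ?_⟩
  rw [uIcc_of_le ht₀.2] at ht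
  have ht' : t ∈ Icc 0 t₁ := ⟨ht₀.1.trans ht.1, ht.2⟩
  exact ⟨hge t ht, (hhG t (hsub ht')).trans (hle t ht'), hle t ht'⟩

/-- The part of a path on which the terminal value `h` runs from `0` to `r` while the maximum `G`
stays above `r + 1`. -/
lemma exists_subpath_large {h G Q : ℝ → ℝ} {r M : ℝ} (hr : 0 < r) (hrM : r < M)
    (hh : ContinuousOn h (Icc 0 1)) (hG : ContinuousOn G (Icc 0 1)) (hQ : ContinuousOn Q (Icc 0 1))
    (hQG : ∀ t ∈ Icc (0 : ℝ) 1, Q t ≤ G t)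
    (hG0 : G 0 ≤ r) (hQ1 : M ≤ Q 1)
    (hGr : ∀ t ∈ Icc (0 : ℝ) 1, G t = r → h t = r)
    (hQM : ∀ t ∈ Icc (0 : ℝ) 1, Q t = M → h t < 0)
    (hdich : ∀ t ∈ Icc (0 : ℝ) 1, 0 ≤ h t → h t ≤ r → r < G t → r + 1 < G t) :
    ∃ e₀ ∈ Icc (0 : ℝ) 1, ∃ e₁ ∈ Icc (0 : ℝ) 1, h e₀ = 0 ∧ h e₁ = r ∧
      ∀ t ∈ uIcc e₀ e₁, 0 ≤ h t ∧ h t ≤ r ∧ r + 1 < G t ∧ Q t ≤ M := by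
  obtain ⟨tM, htM, hQtM, hleM⟩ := exists_first_hit zero_le_one hQ
    (by linarith [hQG 0 ⟨le_rfl, zero_le_one⟩]) hQ1
  have hsubM : Icc 0 tM ⊆ Icc (0 : ℝ) 1 := Icc_subset_Icc_right htM.2
  obtain ⟨t₁, ht₁, hGt₁, hge₁⟩ := exists_last_hit htM.1 (hG.mono hsubM) hG0
    (by linarith [hQG tM htM])
  have hht₁ := hGr t₁ (hsubM ht₁) hGt₁
  have hsub₁ : Icc t₁ tM ⊆ Icc (0 : ℝ) 1 := (Icc_subset_Icc_left ht₁.1).trans hsubM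
  obtain ⟨e₀, he₀, hhe₀, hle₀⟩ := exists_first_hit (f := fun t => -h t) (c := 0) ht₁.2
    (hh.mono hsub₁).neg (by linarith) (by linarith [hQM tM htM hQtM])
  have hsub₀ : Icc t₁ e₀ ⊆ Icc (0 : ℝ) 1 := (Icc_subset_Icc_right he₀.2).trans hsub₁
  obtain ⟨e₁, he₁, hhe₁, hge₂⟩ := exists_last_hit (f := fun t => -h t) (c := -r) he₀.1
    (hh.mono hsub₀).neg (by linarith) (by linarith)
  have key : ∀ t ∈ Icc e₁ e₀, t ∈ Icc (0 : ℝ) 1 ∧ 0 ≤ h t ∧ h t ≤ r ∧ r ≤ G t ∧ Q t ≤ M := by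
    intro t ht
    have ht' : t ∈ Icc t₁ e₀ := ⟨he₁.1.trans ht.1, ht.2⟩
    have htM' : t ∈ Icc t₁ tM := ⟨ht'.1, ht'.2.trans he₀.2⟩
    exact ⟨hsub₀ ht', by linarith [hle₀ t ht'], by linarith [hge₂ t ht], hge₁ t htM',
      hleM t ⟨ht₁.1.trans htM'.1, htM'.2⟩⟩
  have hlarge : ∀ t ∈ Icc e₁ e₀, r < G t → r + 1 < G t := fun t ht hlt =>
    hdich t (key t ht).1 (key t ht).2.1 (key t ht).2.2.1 hlt
  have he₀' : e₀ ∈ Icc e₁ e₀ := ⟨he₁.2, le_rfl⟩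
  have hGe₀ : r + 1 < G e₀ := by
    refine hlarge e₀ he₀' (lt_of_le_of_ne (key e₀ he₀').2.2.2.1 fun heq => ?_)
    have := hGr e₀ (key e₀ he₀').1 heq.symm
    linarith
  refine ⟨e₀, hsub₁ he₀, e₁, hsub₀ he₁, by linarith, by linarith, fun t ht => ?_⟩
  rw [uIcc_of_ge he₁.2] at ht
  obtain ⟨ht01, h1, h2, h3, h4⟩ := key t ht
  refine ⟨h1, h2, ?_, h4⟩
  by_contra! hcon
  obtain ⟨s, hs, hGs⟩ := intermediate_value_Icc ht.2
    (hG.mono fun s hs => (key s ⟨ht.1.trans hs.1, hs.2⟩).1)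
    (show max (G t) (r + 1 / 2) ∈ Icc (G t) (G e₀) from
      ⟨le_max_left _ _, max_le (by linarith) (by linarith)⟩)
  have hs' : s ∈ Icc e₁ e₀ := ⟨ht.1.trans hs.1, hs.2⟩
  have h5 := hlarge s hs' (by
    rw [hGs]
    exact (by linarith : r < r + 1 / 2).trans_le (le_max_right _ _))
  rw [hGs] at h5
  rcases lt_max_iff.1 h5 with h6 | h6 <;> linarith

lemma deriv_nonpos_of_right_max {u : ℝ → ℝ} {d x₀ z : ℝ} (hz : x₀ < z) (hu : HasDerivAt u d x₀)
    (hmax : ∀ x ∈ Icc x₀ z, u x ≤ u x₀) : d ≤ 0 := by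
  have h1 := (hasDerivAt_iff_tendsto_slope.1 hu).mono_left
    (nhdsWithin_mono x₀ fun x (hx : x ∈ Ioi x₀) => ne_of_gt hx)
  refine le_of_tendsto h1 ?_
  filter_upwards [Ioc_mem_nhdsGT hz] with x hx
  rw [slope_def_field]
  exact div_nonpos_of_nonpos_of_nonneg (by linarith [hmax x ⟨hx.1.le, hx.2⟩]) (by linarith [hx.1])

lemma deriv_nonneg_of_left_max {u : ℝ → ℝ} {d x₀ z : ℝ} (hz : z < x₀) (hu : HasDerivAt u d x₀)
    (hmax : ∀ x ∈ Icc z x₀, u x ≤ u x₀) : 0 ≤ d := by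
  have h1 : HasDerivAt (fun x => u (-x)) (-d) (-x₀) := by
    have h2 : HasDerivAt u d (-(-x₀)) := by rwa [neg_neg]
    simpa [Function.comp_def] using h2.comp (-x₀) (hasDerivAt_neg (-x₀))
  have := deriv_nonpos_of_right_max (neg_lt_neg hz) h1 fun x hx => by
    rw [neg_neg]
    exact hmax (-x) ⟨by linarith [hx.2], by linarith [hx.1]⟩
  linarith

/-- Solutions `U s` of `u'' = truncField μ p M a x u` on `[0, L]` starting from `U s 0 = 0`,
depending continuously on `s ∈ [0, S]`, where `truncField` is positive on `(0, r + 1]`. -/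
structure ShootingFamily (L S μ p M r : ℝ) (a : ℝ → ℝ) (U V : ℝ → ℝ → ℝ) : Prop where
  one_lt_p : 1 < p
  mu_pos : 0 < μ
  r_pos : 0 < r
  r_lt : r + 1 < M
  pos_of_small : ∀ x u, 0 < u → u ≤ r + 1 → 0 < truncField μ p M a x u
  deriv_fst : ∀ s ∈ Icc 0 S, ∀ x ∈ Icc 0 L, HasDerivAt (U s) (V s x) x
  deriv_snd : ∀ s ∈ Icc 0 S, ∀ x ∈ Icc 0 L, HasDerivAt (V s) (truncField μ p M a x (U s x)) x
  apply_zero : ∀ s ∈ Icc 0 S, U s 0 = 0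
  unique : ∀ s ∈ Icc 0 S, ∀ x₀ ∈ Icc 0 L, U s x₀ = 0 → V s x₀ = 0 → ∀ x ∈ Icc 0 L, U s x = 0
  continuous : ∃ g : ℝ → ℝ → ℝ, Continuous ↿g ∧ ∀ s ∈ Icc 0 S, ∀ x ∈ Icc 0 L, g s x = U s x

namespace ShootingFamily

variable {L S μ p M r : ℝ} {a : ℝ → ℝ} {U V : ℝ → ℝ → ℝ}

lemma M_pos (F : ShootingFamily L S μ p M r a U V) : 0 < M := by
  linarith [F.r_pos, F.r_lt]

lemma nonneg (F : ShootingFamily L S μ p M r a U V) {s z : ℝ} (hs : s ∈ Icc 0 S)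
    (hz : z ∈ Icc 0 L) (h : 0 ≤ U s z) : ∀ x ∈ Icc 0 z, 0 ≤ U s x :=
  nonneg_of_snd_deriv_neg (fun x hx => F.deriv_fst s hs x ⟨hx.1, hx.2.trans hz.2⟩)
    (fun x hx => F.deriv_snd s hs x ⟨hx.1, hx.2.trans hz.2⟩)
    (fun x _ hneg => truncField_neg F.one_lt_p F.mu_pos F.M_pos hneg x)
    (F.apply_zero s hs).ge h

lemma no_max (F : ShootingFamily L S μ p M r a U V) {s x₀ y z : ℝ} (hs : s ∈ Icc 0 S)
    (hy : 0 ≤ y) (hz : z ≤ L) (hx₀ : x₀ ∈ Ioo y z) (hmax : ∀ x ∈ Icc y z, U s x ≤ U s x₀)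
    (hpos : 0 < U s x₀) (h : U s x₀ ≤ r + 1 ∨ a x₀ ≤ 0) : False := by
  have h1 := (deriv_zero_and_snd_deriv_nonpos_of_max hx₀
    (fun x hx => F.deriv_fst s hs x ⟨hy.trans hx.1, hx.2.trans hz⟩)
    (fun x hx => F.deriv_snd s hs x ⟨hy.trans hx.1, hx.2.trans hz⟩) hmax).2
  rcases h with h | h
  · exact (F.pos_of_small x₀ _ hpos h).not_ge h1
  · exact (truncField_pos_of_nonpos F.mu_pos F.M_pos hpos h).not_ge h1

/-- Where `a` is nonpositive, `U s` is bounded by the values at the end points. -/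
lemma le_of_nonpos (F : ShootingFamily L S μ p M r a U V) {s y z B : ℝ} (hs : s ∈ Icc 0 S)
    (hy : 0 ≤ y) (hz : z ≤ L) (ha : ∀ x ∈ Ioo y z, a x ≤ 0) (hB : 0 ≤ B) (hyB : U s y ≤ B)
    (hzB : U s z ≤ B) : ∀ x ∈ Icc y z, U s x ≤ B := by
  intro x hx
  obtain ⟨x₀, hx₀, hmax⟩ := exists_max_Icc (hx.1.trans hx.2) (fun x hx =>
    (F.deriv_fst s hs x ⟨hy.trans hx.1, hx.2.trans hz⟩).continuousAt.continuousWithinAt)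
  refine (hmax x hx).trans ?_
  by_contra! hcon
  have hne : x₀ ≠ y := by rintro rfl; linarith
  have hne' : x₀ ≠ z := by rintro rfl; linarith
  have hx₀' : x₀ ∈ Ioo y z := ⟨lt_of_le_of_ne hx₀.1 hne.symm, lt_of_le_of_ne hx₀.2 hne'⟩
  exact F.no_max hs hy hz hx₀' hmax (by linarith) (Or.inr (ha x₀ hx₀'))

lemma exists_continuous_max (F : ShootingFamily L S μ p M r a U V) {y z : ℝ} (hy : 0 ≤ y)
    (hyz : y ≤ z) (hz : z ≤ L) :
    ∃ G : ℝ → ℝ, Continuous G ∧ ∀ s ∈ Icc 0 S, ∃ x₀ ∈ Icc y z, G s = U s x₀ ∧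
      ∀ x ∈ Icc y z, U s x ≤ U s x₀ := by
  obtain ⟨g, hg, hgU⟩ := F.continuous
  refine ⟨fun s => sSup (g s '' Icc y z), isCompact_Icc.continuous_sSup hg, fun s hs => ?_⟩
  have hgc : ContinuousOn (g s) (Icc y z) :=
    (hg.comp (continuous_const.prodMk continuous_id)).continuousOn
  have hsub : ∀ x ∈ Icc y z, x ∈ Icc 0 L := fun x hx => ⟨hy.trans hx.1, hx.2.trans hz⟩
  obtain ⟨x₀, hx₀, hmax⟩ := exists_max_Icc hyz hgc
  refine ⟨x₀, hx₀, ?_, fun x hx => ?_⟩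
  · rw [← hgU s hs x₀ (hsub x₀ hx₀)]
    refine IsGreatest.csSup_eq ⟨mem_image_of_mem _ hx₀, ?_⟩
    rintro _ ⟨x, hx, rfl⟩
    exact hmax x hx
  · rw [← hgU s hs x (hsub x hx), ← hgU s hs x₀ (hsub x₀ hx₀)]
    exact hmax x hx

/-- Crossing one peak: a path of initial data on which the solutions leave `m` with values at most
`r` contains a subpath on which the value at `m'` runs from `0` to `r`, with a prescribed height of
the solutions on `(σ, τ)`. -/
lemma exists_crossing (F : ShootingFamily L S μ p M r a U V) {m σ τ m' : ℝ} (hm : 0 ≤ m)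
    (hmσ : m ≤ σ) (hστ : σ < τ) (hτm : τ ≤ m') (hm' : m' ≤ L)
    (haσ : ∀ x ∈ Ioo m σ, a x ≤ 0) (haτ : ∀ x ∈ Ioo τ m', a x ≤ 0)
    (hlarge : ∀ u v w : ℝ → ℝ, (∀ x ∈ Icc σ τ, HasDerivAt u (v x) x) →
      (∀ x ∈ Icc σ τ, HasDerivAt v (w x) x) → (∀ x ∈ Icc σ τ, 0 ≤ u x ∧ u x ≤ M) →
      (∀ x ∈ Icc σ τ, w x = μ * u x - a x * u x ^ p) → ∀ y ∈ Icc σ τ, u y = M →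
      (y < τ → v y ≤ 0) → (σ < y → 0 ≤ v y) → False)
    {c : ℝ → ℝ} (hc : Continuous c) (hcS : ∀ t ∈ Icc (0 : ℝ) 1, c t ∈ Icc 0 S)
    (hUm : ∀ t ∈ Icc (0 : ℝ) 1, U (c t) m ≤ r)
    (hVm : ∀ t ∈ Icc (0 : ℝ) 1, U (c t) m = r → 0 < V (c t) m)
    (hU0 : ∀ x ∈ Icc m L, U (c 0) x ≤ 0) (hU1 : ∃ x ∈ Icc m τ, M ≤ U (c 1) x) (b : Prop) :
    ∃ e₀ ∈ Icc (0 : ℝ) 1, ∃ e₁ ∈ Icc (0 : ℝ) 1, U (c e₀) m' = 0 ∧ U (c e₁) m' = r ∧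
      ∀ t ∈ uIcc e₀ e₁, 0 ≤ U (c t) m' ∧ U (c t) m' ≤ r ∧
        (∀ x ∈ Icc m m', U (c t) x ≤ M) ∧ (b → ∃ x ∈ Ioo σ τ, r + 1 < U (c t) x) ∧
        (¬ b → ∀ x ∈ Ioo σ τ, U (c t) x ≤ r) := by
  have hr := F.r_pos
  have hrM := F.r_lt
  have hmτ : m ≤ τ := hmσ.trans hστ.le
  have hmm' : m ≤ m' := hmτ.trans hτm
  obtain ⟨h', hh', hh⟩ := F.exists_continuous_max (hm.trans hmm') le_rfl hm'
  obtain ⟨G', hG', hG⟩ := F.exists_continuous_max hm hmm' hm'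
  obtain ⟨Q', hQ', hQ⟩ := F.exists_continuous_max hm hmτ (hτm.trans hm')
  have hh : ∀ t ∈ Icc (0 : ℝ) 1, h' (c t) = U (c t) m' := by
    intro t ht
    obtain ⟨x, hx, hxe, -⟩ := hh _ (hcS t ht)
    rw [hxe, le_antisymm hx.2 hx.1]
  have hUG : ∀ t ∈ Icc (0 : ℝ) 1, ∀ x ∈ Icc m m', U (c t) x ≤ G' (c t) := by
    intro t ht x hx
    obtain ⟨x₀, -, hxe, hmax⟩ := hG _ (hcS t ht)
    exact hxe ▸ hmax x hx
  have hUQ : ∀ t ∈ Icc (0 : ℝ) 1, ∀ x ∈ Icc m τ, U (c t) x ≤ Q' (c t) := by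
    intro t ht x hx
    obtain ⟨x₀, -, hxe, hmax⟩ := hQ _ (hcS t ht)
    exact hxe ▸ hmax x hx
  have hhG : ∀ t ∈ Icc (0 : ℝ) 1, h' (c t) ≤ G' (c t) := fun t ht =>
    hh t ht ▸ hUG t ht m' ⟨hmm', le_rfl⟩
  have hQG : ∀ t ∈ Icc (0 : ℝ) 1, Q' (c t) ≤ G' (c t) := by
    intro t ht
    obtain ⟨x₀, hx₀, hxe, -⟩ := hQ _ (hcS t ht)
    exact hxe ▸ hUG t ht x₀ ⟨hx₀.1, hx₀.2.trans hτm⟩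
  have h01 : (0 : ℝ) ∈ Icc (0 : ℝ) 1 := ⟨le_rfl, zero_le_one⟩
  have h11 : (1 : ℝ) ∈ Icc (0 : ℝ) 1 := ⟨zero_le_one, le_rfl⟩
  have hh0 : h' (c 0) ≤ 0 := hh 0 h01 ▸ hU0 m' ⟨hmm', hm'⟩
  have hG0 : G' (c 0) ≤ r := by
    obtain ⟨x₀, hx₀, hxe, -⟩ := hG _ (hcS 0 h01)
    rw [hxe]
    exact (hU0 x₀ ⟨hx₀.1, hx₀.2.trans hm'⟩).trans hr.le
  have hQ1 : M ≤ Q' (c 1) := by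
    obtain ⟨x, hx, hMx⟩ := hU1
    exact hMx.trans (hUQ 1 h11 x hx)
  have hGr : ∀ t ∈ Icc (0 : ℝ) 1, G' (c t) = r → h' (c t) = r := by
    intro t ht hGt
    obtain ⟨x₀, hx₀, hxe, hmax⟩ := hG _ (hcS t ht)
    rw [hGt] at hxe
    by_cases h2 : x₀ = m'
    · rw [hh t ht, ← h2, hxe]
    by_cases h1 : x₀ = m
    · subst h1
      exfalso
      have hV := hVm t ht hxe.symm
      exact hV.not_ge (deriv_nonpos_of_right_max (hmσ.trans_lt (hστ.trans_le hτm))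
        (F.deriv_fst _ (hcS t ht) _ ⟨hm, hmm'.trans hm'⟩) hmax)
    · exact (F.no_max (hcS t ht) hm hm'
        ⟨lt_of_le_of_ne hx₀.1 (Ne.symm h1), lt_of_le_of_ne hx₀.2 h2⟩ hmax (hxe ▸ hr)
        (Or.inl (by linarith))).elim
  have hQM : ∀ t ∈ Icc (0 : ℝ) 1, Q' (c t) = M → h' (c t) < 0 := by
    intro t ht hQt
    by_contra! hcon
    rw [hh t ht] at hcon
    have hpos := F.nonneg (hcS t ht) ⟨hm.trans hmm', hm'⟩ hcon
    obtain ⟨x₀, hx₀, hxe, hmax⟩ := hQ _ (hcS t ht)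
    rw [hQt] at hxe
    have h1 : x₀ ≠ m := by
      rintro rfl
      linarith [hUm t ht]
    rcases lt_or_ge x₀ σ with h2 | h2
    · have h3 : x₀ ∈ Ioo m σ := ⟨lt_of_le_of_ne hx₀.1 h1.symm, h2⟩
      exact F.no_max (hcS t ht) hm (hτm.trans hm') ⟨h3.1, h2.trans hστ⟩ hmax
        (hxe ▸ F.M_pos) (Or.inr (haσ x₀ h3))
    · have hsub : ∀ x ∈ Icc σ τ, x ∈ Icc 0 L := fun x hx =>
        ⟨hm.trans (hmσ.trans hx.1), hx.2.trans (hτm.trans hm')⟩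
      have hbd : ∀ x ∈ Icc σ τ, 0 ≤ U (c t) x ∧ U (c t) x ≤ M := fun x hx =>
        ⟨hpos x ⟨(hsub x hx).1, hx.2.trans hτm⟩, hxe ▸ hmax x ⟨hmσ.trans hx.1, hx.2⟩⟩
      have hd := F.deriv_fst _ (hcS t ht) x₀ (hsub x₀ ⟨h2, hx₀.2⟩)
      refine hlarge (U (c t)) (V (c t)) (fun x => truncField μ p M a x (U (c t) x))
        (fun x hx => F.deriv_fst _ (hcS t ht) x (hsub x hx))
        (fun x hx => F.deriv_snd _ (hcS t ht) x (hsub x hx)) hbd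
        (fun x hx => truncField_of_mem (hbd x hx).1 (hbd x hx).2 x) x₀ ⟨h2, hx₀.2⟩ hxe.symm
        (fun h => ?_) (fun h => ?_)
      · exact deriv_nonpos_of_right_max h hd fun x hx => hmax x ⟨hx₀.1.trans hx.1, hx.2⟩
      · exact deriv_nonneg_of_left_max h hd fun x hx =>
          hmax x ⟨hmσ.trans hx.1, hx.2.trans hx₀.2⟩
  have hdich : ∀ t ∈ Icc (0 : ℝ) 1, 0 ≤ h' (c t) → h' (c t) ≤ r → r < G' (c t) →
      r + 1 < G' (c t) := by
    intro t ht _ hle hlt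
    by_contra! hcon
    obtain ⟨x₀, hx₀, hxe, hmax⟩ := hG _ (hcS t ht)
    rw [hxe] at hlt hcon
    rw [hh t ht] at hle
    have h1 : x₀ ≠ m := by
      rintro rfl
      linarith [hUm t ht]
    have h2 : x₀ ≠ m' := by
      rintro rfl
      linarith
    exact F.no_max (hcS t ht) hm hm' ⟨lt_of_le_of_ne hx₀.1 h1.symm, lt_of_le_of_ne hx₀.2 h2⟩
      hmax (by linarith) (Or.inl hcon)
  by_cases hb : b
  · obtain ⟨e₀, he₀, e₁, he₁, hhe₀, hhe₁, H⟩ := exists_subpath_large (h := fun t => h' (c t))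
      (G := fun t => G' (c t)) (Q := fun t => Q' (c t)) hr (by linarith : r < M)
      (hh'.comp hc).continuousOn (hG'.comp hc).continuousOn (hQ'.comp hc).continuousOn
      hQG hG0 hQ1 hGr hQM hdich
    refine ⟨e₀, he₀, e₁, he₁, hh e₀ he₀ ▸ hhe₀, hh e₁ he₁ ▸ hhe₁, fun t ht => ?_⟩
    have ht01 : t ∈ Icc (0 : ℝ) 1 := uIcc_subset_Icc he₀ he₁ ht
    obtain ⟨H1, H2, H3, H4⟩ := H t ht
    rw [hh t ht01] at H1 H2
    refine ⟨H1, H2, ?_, fun _ => ?_, fun h => (h hb).elim⟩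
    · intro x hx
      rcases le_total x τ with hxτ | hxτ
      · exact (hUQ t ht01 x ⟨hx.1, hxτ⟩).trans H4
      · exact F.le_of_nonpos (hcS t ht01) (hm.trans hmτ) hm' haτ F.M_pos.le
          ((hUQ t ht01 τ ⟨hmτ, le_rfl⟩).trans H4) (by linarith) x ⟨hxτ, hx.2⟩
    · by_contra! hcon
      have hcont : ContinuousOn (U (c t)) (Icc σ τ) := fun x hx =>
        (F.deriv_fst _ (hcS t ht01) x ⟨hm.trans (hmσ.trans hx.1), hx.2.trans (hτm.trans hm')⟩
          ).continuousAt.continuousWithinAt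
      have hle : ∀ x ∈ Icc σ τ, U (c t) x ≤ r + 1 := by
        rw [← closure_Ioo hστ.ne] at hcont ⊢
        intro x hx
        exact le_on_closure hcon hcont continuousOn_const hx
      obtain ⟨x₀, hx₀, hxe, -⟩ := hG _ (hcS t ht01)
      have : U (c t) x₀ ≤ r + 1 := by
        rcases le_total x₀ σ with h1 | h1
        · exact F.le_of_nonpos (hcS t ht01) hm (hστ.le.trans (hτm.trans hm')) haσ (by linarith)
            (by linarith [hUm t ht01]) (hle σ ⟨le_rfl, hστ.le⟩) x₀ ⟨hx₀.1, h1⟩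
        rcases le_total x₀ τ with h2 | h2
        · exact hle x₀ ⟨h1, h2⟩
        · exact F.le_of_nonpos (hcS t ht01) (hm.trans hmτ) hm' haτ (by linarith)
            (hle τ ⟨hστ.le, le_rfl⟩) (by linarith) x₀ ⟨h2, hx₀.2⟩
      linarith
  · obtain ⟨e₀, he₀, e₁, he₁, hhe₀, hhe₁, H⟩ := exists_subpath_small (h := fun t => h' (c t))
      (G := fun t => G' (c t)) (Q := fun t => Q' (c t)) hr (by linarith : r < M)
      (hh'.comp hc).continuousOn (hG'.comp hc).continuousOn hhG hQG hh0 hG0 hQ1 hGr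
    refine ⟨e₀, he₀, e₁, he₁, hh e₀ he₀ ▸ hhe₀, hh e₁ he₁ ▸ hhe₁, fun t ht => ?_⟩
    have ht01 : t ∈ Icc (0 : ℝ) 1 := uIcc_subset_Icc he₀ he₁ ht
    obtain ⟨H1, H2, H3⟩ := H t ht
    rw [hh t ht01] at H1 H2
    refine ⟨H1, H2, fun x hx => ?_, fun h => (hb h).elim, fun _ x hx => ?_⟩
    · linarith [hUG t ht01 x hx]
    · exact (hUG t ht01 x ⟨hmσ.trans hx.1.le, hx.2.le.trans hτm⟩).trans H3

/-- At a point of a valley, a solution with value `r` that was bounded by `M` before is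
increasing. -/
lemma deriv_pos_of_eq (F : ShootingFamily L S μ p M r a U V) {s m η α : ℝ} (hs : s ∈ Icc 0 S)
    (hα : 0 < α) (hmη : 0 ≤ m - η) (hmL : m ≤ L)
    (ha : ∀ x ∈ Icc (m - η) (m + η), a x ≤ -α)
    (hKO : ∀ (u v w : ℝ → ℝ) (y : ℝ), (∀ x ∈ Icc y (y + η), HasDerivAt u (v x) x) →
      (∀ x ∈ Icc y (y + η), HasDerivAt v (w x) x) →
      (∀ x ∈ Icc y (y + η), 0 ≤ u x → u x ≤ M → α * u x ^ p ≤ w x) →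
      (∀ x ∈ Icc y (y + η), 0 ≤ u x → 0 ≤ w x) → u y = r → 0 ≤ v y →
      ∃ x ∈ Icc y (y + η), M ≤ u x)
    (hM : ∀ x ∈ Icc 0 m, U s x ≤ M) (hr : U s m = r) : 0 < V s m := by
  by_contra! hV
  have hsub : ∀ x ∈ Icc m (m + η), 2 * m - x ∈ Icc 0 L := fun x hx =>
    ⟨by linarith [hx.2], by linarith [hx.1]⟩
  have hsub' : ∀ x ∈ Icc m (m + η), 2 * m - x ∈ Icc (m - η) (m + η) := fun x hx =>
    ⟨by linarith [hx.2], by linarith [hx.1, hx.2]⟩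
  have e1 : 2 * m - m = m := by ring
  have hlin : ∀ x, HasDerivAt (fun x => 2 * m - x) (-1) x := fun x =>
    (hasDerivAt_id x).const_sub (2 * m)
  obtain ⟨x, hx, hMx⟩ := hKO (fun x => U s (2 * m - x)) (fun x => -V s (2 * m - x))
    (fun x => truncField μ p M a (2 * m - x) (U s (2 * m - x))) m
    (fun x hx => ((F.deriv_fst s hs _ (hsub x hx)).comp x (hlin x)).congr_deriv (by ring))
    (fun x hx => ((F.deriv_snd s hs _ (hsub x hx)).comp x (hlin x)).neg.congr_deriv (by ring))
    (fun x hx h0 hM => mul_rpow_le_truncField F.mu_pos (ha _ (hsub' x hx)) h0 hM)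
    (fun x hx h0 => truncField_nonneg_of_nonpos F.mu_pos F.M_pos h0
      (by linarith [ha _ (hsub' x hx)]))
    (by rw [e1, hr]) (by rw [e1]; linarith)
  have hM' := hsub x hx
  have hle : 2 * m - x ≤ m := by linarith [hx.1]
  have heq : U s (2 * m - x) = M := le_antisymm (hM _ ⟨hM'.1, hle⟩) hMx
  have h0 : (0 : ℝ) ≠ 2 * m - x := by
    intro h
    rw [← h, F.apply_zero s hs] at heq
    exact F.M_pos.ne heq
  have h1 : 2 * m - x ≠ m := by
    intro h
    rw [h, hr] at heq
    linarith [F.r_lt]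
  exact F.no_max hs le_rfl hmL ⟨lt_of_le_of_ne hM'.1 h0, lt_of_le_of_ne hle h1⟩
    (fun y hy => heq ▸ hM y hy) (heq ▸ F.M_pos) (Or.inr (by linarith [ha _ (hsub' x hx)]))

/-- At a point of a valley, a solution that is nondecreasing with value `r` becomes as large
as `M`. -/
lemma exists_ge_of_eq (F : ShootingFamily L S μ p M r a U V) {s m η α : ℝ} (hs : s ∈ Icc 0 S)
    (hα : 0 < α) (hm : 0 ≤ m) (hmL : m + η ≤ L)
    (ha : ∀ x ∈ Icc (m - η) (m + η), a x ≤ -α)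
    (hKO : ∀ (u v w : ℝ → ℝ) (y : ℝ), (∀ x ∈ Icc y (y + η), HasDerivAt u (v x) x) →
      (∀ x ∈ Icc y (y + η), HasDerivAt v (w x) x) →
      (∀ x ∈ Icc y (y + η), 0 ≤ u x → u x ≤ M → α * u x ^ p ≤ w x) →
      (∀ x ∈ Icc y (y + η), 0 ≤ u x → 0 ≤ w x) → u y = r → 0 ≤ v y →
      ∃ x ∈ Icc y (y + η), M ≤ u x)
    (hr : U s m = r) (hV : 0 ≤ V s m) : ∃ x ∈ Icc m (m + η), M ≤ U s x := by
  have hsub : ∀ x ∈ Icc m (m + η), x ∈ Icc 0 L := fun x hx => ⟨hm.trans hx.1, hx.2.trans hmL⟩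
  have hsub' : ∀ x ∈ Icc m (m + η), x ∈ Icc (m - η) (m + η) := fun x hx =>
    ⟨by linarith [hx.1, hx.2], hx.2⟩
  exact hKO (U s) (V s) (fun x => truncField μ p M a x (U s x)) m
    (fun x hx => F.deriv_fst s hs x (hsub x hx)) (fun x hx => F.deriv_snd s hs x (hsub x hx))
    (fun x hx h0 hM => mul_rpow_le_truncField F.mu_pos (ha _ (hsub' x hx)) h0 hM)
    (fun x hx h0 => truncField_nonneg_of_nonpos F.mu_pos F.M_pos h0
      (by linarith [ha _ (hsub' x hx)])) hr hV

/-- After an interior zero, `U s` is nonpositive. -/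
lemma nonpos_of_eq_zero (F : ShootingFamily L S μ p M r a U V) {s m : ℝ} (hs : s ∈ Icc 0 S)
    (hm : 0 < m) (h0 : U s m = 0) : ∀ x ∈ Icc m L, U s x ≤ 0 := by
  intro x hx
  by_contra! hpos
  have hx0 : x ∈ Icc 0 L := ⟨hm.le.trans hx.1, hx.2⟩
  have hne : m ≠ x := by
    rintro rfl
    exact hpos.ne' h0
  have hmx : m < x := lt_of_le_of_ne hx.1 hne
  have hnn := F.nonneg hs hx0 hpos.le
  have hV : V s m = 0 := by
    refine IsLocalMin.hasDerivAt_eq_zero ?_ (F.deriv_fst s hs m ⟨hm.le, hx.1.trans hx.2⟩)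
    filter_upwards [Icc_mem_nhds hm hmx] with y hy
    rw [h0]
    exact hnn y hy
  exact hpos.ne' (F.unique s hs m ⟨hm.le, hx.1.trans hx.2⟩ h0 hV x hx0)

/-- A path `c` of initial slopes whose solutions are admissible on `[0, m i]`: they lie between `0`
and `M`, end below `r`, and have the prescribed heights on the first `i` intervals `(σ j, τ j)`. -/
def IsAdmissiblePath (S M r : ℝ) (U : ℝ → ℝ → ℝ) (m σ τ : ℕ → ℝ) (I : Finset ℕ) (i : ℕ)
    (c : ℝ → ℝ) : Prop :=
  Continuous c ∧ ∀ t ∈ Icc (0 : ℝ) 1, c t ∈ Icc 0 S ∧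
    (∀ x ∈ Icc 0 (m i), 0 ≤ U (c t) x ∧ U (c t) x ≤ M) ∧ U (c t) (m i) ≤ r ∧
    ∀ j, 1 ≤ j → j ≤ i → (j ∈ I → ∃ x ∈ Ioo (σ j) (τ j), r + 1 < U (c t) x) ∧
      (j ∉ I → ∀ x ∈ Ioo (σ j) (τ j), U (c t) x ≤ r)

lemma exists_admissiblePath (F : ShootingFamily L S μ p M r a U V) (hS : 0 ≤ S)
    {n : ℕ} {m σ τ : ℕ → ℝ} (hm0 : m 0 = 0) (hmn : m n = L)
    (hmσ : ∀ i < n, m i ≤ σ (i + 1)) (hστ : ∀ i < n, σ (i + 1) < τ (i + 1))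
    (hτm : ∀ i < n, τ (i + 1) ≤ m (i + 1))
    (haσ : ∀ i < n, ∀ x ∈ Ioo (m i) (σ (i + 1)), a x ≤ 0)
    (haτ : ∀ i < n, ∀ x ∈ Ioo (τ (i + 1)) (m (i + 1)), a x ≤ 0)
    (hlarge : ∀ i < n, ∀ u v w : ℝ → ℝ,
      (∀ x ∈ Icc (σ (i + 1)) (τ (i + 1)), HasDerivAt u (v x) x) →
      (∀ x ∈ Icc (σ (i + 1)) (τ (i + 1)), HasDerivAt v (w x) x) →
      (∀ x ∈ Icc (σ (i + 1)) (τ (i + 1)), 0 ≤ u x ∧ u x ≤ M) →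
      (∀ x ∈ Icc (σ (i + 1)) (τ (i + 1)), w x = μ * u x - a x * u x ^ p) →
      ∀ y ∈ Icc (σ (i + 1)) (τ (i + 1)), u y = M →
      (y < τ (i + 1) → v y ≤ 0) → (σ (i + 1) < y → 0 ≤ v y) → False)
    (hrestart : ∀ i, 1 ≤ i → i < n → ∀ s ∈ Icc 0 S, (∀ x ∈ Icc 0 (m i), U s x ≤ M) →
      U s (m i) = r → 0 < V s (m i) ∧ ∃ x ∈ Icc (m i) (τ (i + 1)), M ≤ U s x)
    (hU0 : ∀ x ∈ Icc 0 L, U 0 x = 0) (hU1 : ∃ x ∈ Icc 0 (τ 1), M ≤ U S x)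
    (I : Finset ℕ) (i : ℕ) (hi : i < n) :
    ∃ c, IsAdmissiblePath S M r U m σ τ I (i + 1) c ∧ U (c 0) (m (i + 1)) = 0 ∧
      U (c 1) (m (i + 1)) = r := by
  have h01 : (0 : ℝ) ∈ Icc (0 : ℝ) 1 := ⟨le_rfl, zero_le_one⟩
  have h11 : (1 : ℝ) ∈ Icc (0 : ℝ) 1 := ⟨zero_le_one, le_rfl⟩
  have hmsucc : ∀ i < n, m i < m (i + 1) := fun i hi =>
    (hmσ i hi).trans_lt ((hστ i hi).trans_le (hτm i hi))
  have hmge : ∀ i ≤ n, 0 ≤ m i := by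
    intro i
    induction i with
    | zero => exact fun _ => hm0.ge
    | succ i ih => exact fun h => (ih (by omega)).trans (hmsucc i (by omega)).le
  have hmle : ∀ i ≤ n, m i ≤ L := by
    intro i hin
    induction hin using Nat.decreasingInduction with
    | self => exact hmn.le
    | of_succ k hk ih => exact (hmsucc k hk).le.trans ih
  have cross : ∀ i < n, ∀ c, IsAdmissiblePath S M r U m σ τ I i c →
      (∀ t ∈ Icc (0 : ℝ) 1, U (c t) (m i) = r → 0 < V (c t) (m i)) →
      (∀ x ∈ Icc (m i) L, U (c 0) x ≤ 0) → (∃ x ∈ Icc (m i) (τ (i + 1)), M ≤ U (c 1) x) →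
      ∃ c, IsAdmissiblePath S M r U m σ τ I (i + 1) c ∧ U (c 0) (m (i + 1)) = 0 ∧
        U (c 1) (m (i + 1)) = r := by
    intro i hi c ⟨hc, hcp⟩ hV h0 h1
    obtain ⟨e₀, he₀, e₁, he₁, hz₀, hz₁, H⟩ := F.exists_crossing (hmge i hi.le) (hmσ i hi)
      (hστ i hi) (hτm i hi) (hmle (i + 1) hi) (haσ i hi) (haτ i hi) (hlarge i hi) hc
      (fun t ht => (hcp t ht).1) (fun t ht => (hcp t ht).2.2.1) hV h0 h1 (i + 1 ∈ I)
    refine ⟨fun t => c (e₀ + (e₁ - e₀) * t), ⟨by fun_prop, fun t ht => ?_⟩, by simpa using hz₀,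
      by simpa using hz₁⟩
    have ht' : e₀ + (e₁ - e₀) * t ∈ uIcc e₀ e₁ := by
      rcases le_total e₀ e₁ with h | h
      · rw [uIcc_of_le h]
        constructor <;> nlinarith [ht.1, ht.2]
      · rw [uIcc_of_ge h]
        constructor <;> nlinarith [ht.1, ht.2]
    obtain ⟨H1, H2, H3, H4, H5⟩ := H _ ht'
    obtain ⟨P1, P2, -, P4⟩ := hcp _ (uIcc_subset_Icc he₀ he₁ ht')
    have hnn := F.nonneg P1 ⟨hmge (i + 1) hi, hmle (i + 1) hi⟩ H1
    refine ⟨P1, fun x hx => ⟨hnn x hx, ?_⟩, H2, fun j hj1 hji => ?_⟩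
    · rcases le_total x (m i) with h | h
      · exact (P2 x ⟨hx.1, h⟩).2
      · exact H3 x ⟨h, hx.2⟩
    · rcases Nat.lt_or_ge i j with h | h
      · obtain rfl : j = i + 1 := by omega
        exact ⟨H4, H5⟩
      · exact P4 j hj1 h
  induction i with
  | zero =>
    have hSt : ∀ t ∈ Icc (0 : ℝ) 1, S * t ∈ Icc 0 S := fun t ht =>
      ⟨mul_nonneg hS ht.1, by nlinarith [ht.2]⟩
    have hm00 : ∀ t ∈ Icc (0 : ℝ) 1, U (S * t) (m 0) = 0 := fun t ht => by
      rw [hm0, F.apply_zero _ (hSt t ht)]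
    refine cross 0 hi (fun t => S * t) ⟨by fun_prop, fun t ht => ⟨hSt t ht, fun x hx => ?_, ?_,
      fun j hj hj' => by omega⟩⟩ (fun t ht h => ?_) (fun x hx => ?_) ?_
    · obtain rfl : x = m 0 := le_antisymm hx.2 (hm0 ▸ hx.1)
      rw [hm00 t ht]
      exact ⟨le_rfl, F.M_pos.le⟩
    · rw [hm00 t ht]
      exact F.r_pos.le
    · rw [hm00 t ht] at h
      exact (F.r_pos.ne h).elim
    · rw [hm0] at hx
      simp [hU0 x hx]
    · simpa [hm0] using hU1
  | succ i ih =>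
    obtain ⟨c, hc, hz₀, hz₁⟩ := ih (by omega)
    have hre := fun t ht => hrestart (i + 1) (by omega) hi (c t) (hc.2 t ht).1
      (fun x hx => ((hc.2 t ht).2.1 x hx).2)
    exact cross (i + 1) hi c hc (fun t ht h => (hre t ht h).1)
      (F.nonpos_of_eq_zero (hc.2 0 h01).1
        ((hmge i (by omega)).trans_lt (hmsucc i (by omega))) hz₀) (hre 1 h11 hz₁).2

end ShootingFamily

lemma exists_shootingFamily {L p μ M r A ℓ : ℝ} {a : ℝ → ℝ} (hp : 1 < p) (hr : 0 < r)
    (hrM : r + 1 < M) (ha : Continuous a) (hA : ∀ x, |a x| ≤ A) (hA0 : 0 ≤ A)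
    (hμ : A * (r + 1) ^ (p - 1) < μ) (hℓ : 0 < ℓ) (hℓL : ℓ ≤ L) :
    ∃ S, 0 ≤ S ∧ ∃ U V, ShootingFamily L S μ p M r a U V ∧ (∀ x ∈ Icc 0 L, U 0 x = 0) ∧
      ∃ x ∈ Icc 0 ℓ, M ≤ U S x := by
  have hM : 1 ≤ M := by linarith
  have hμ0 : 0 < μ := lt_of_le_of_lt (by positivity) hμ
  obtain ⟨C, hC⟩ : ∃ C : NNReal, (C : ℝ) = μ * M + A * M ^ p :=
    ⟨⟨μ * M + A * M ^ p, by positivity⟩, rfl⟩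
  have hfb : ∀ x u, |truncField μ p M a x u| ≤ C := fun x u =>
    hC ▸ abs_truncField_le hp hμ0 hM hA x u
  obtain ⟨K, hK⟩ := exists_lipschitzWith_truncField (μ := μ) hp hM hA
  set S : ℝ := (M + C * ℓ ^ 2 / 2) / ℓ with hS
  have hS0 : 0 ≤ S := by positivity
  obtain ⟨U, V, hU, hV, hinit, huniq, hcont⟩ := exists_shooting_flow (hℓ.trans_le hℓL) hS0
    (continuous_truncField ha) hfb hK (truncField_zero hp (by linarith))
  refine ⟨S, hS0, U, V, ⟨hp, hμ0, hr, hrM, fun x u hu hur =>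
    truncField_pos_of_small hp hrM.le hA hμ hu hur x, hU, hV, fun s hs => (hinit s hs).1, huniq,
    hcont⟩, ?_, ℓ, ⟨hℓ.le, le_rfl⟩, ?_⟩
  · have h0 : (0 : ℝ) ∈ Icc 0 S := ⟨le_rfl, hS0⟩
    exact huniq 0 h0 0 ⟨le_rfl, hℓ.le.trans hℓL⟩ (hinit 0 h0).1 (hinit 0 h0).2
  · have hSS : S ∈ Icc 0 S := ⟨hS0, le_rfl⟩
    have h1 := (le_taylor (C := -C) (fun x (hx : x ∈ Icc 0 ℓ) => hU S hSS x ⟨hx.1, hx.2.trans hℓL⟩)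
      (fun x hx => hV S hSS x ⟨hx.1, hx.2.trans hℓL⟩) (fun x _ => (abs_le.1 (hfb x _)).1) ℓ
      ⟨hℓ.le, le_rfl⟩).2
    rw [(hinit S hSS).1, (hinit S hSS).2, sub_zero] at h1
    have h2 : S * ℓ = M + C * ℓ ^ 2 / 2 := div_mul_cancel₀ _ hℓ.ne'
    linarith

lemma exists_compact_valley {a : ℝ → ℝ} {τ σ : ℝ} (h : τ < σ) (ha : ContinuousOn a (Icc τ σ))
    (hneg : ∀ x ∈ Ioo τ σ, a x < 0) :
    ∃ η > 0, ∃ α > 0, τ ≤ (τ + σ) / 2 - η ∧ (τ + σ) / 2 + η ≤ σ ∧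
      ∀ x ∈ Icc ((τ + σ) / 2 - η) ((τ + σ) / 2 + η), a x ≤ -α := by
  have hsub : ∀ x ∈ Icc ((τ + σ) / 2 - (σ - τ) / 4) ((τ + σ) / 2 + (σ - τ) / 4), x ∈ Ioo τ σ :=
    fun x hx => ⟨by linarith [hx.1], by linarith [hx.2]⟩
  obtain ⟨x₀, hx₀, hmax⟩ := exists_max_Icc
    (by linarith : (τ + σ) / 2 - (σ - τ) / 4 ≤ (τ + σ) / 2 + (σ - τ) / 4)
    (ha.mono fun x hx => Ioo_subset_Icc_self (hsub x hx))
  refine ⟨(σ - τ) / 4, by linarith, -a x₀, by linarith [hneg x₀ (hsub x₀ hx₀)], by linarith,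
    by linarith, fun x hx => ?_⟩
  rw [neg_neg]
  exact hmax x hx

lemma exists_solutions_of_continuous {L p A : ℝ} (hp : 1 < p) {a : ℝ → ℝ}
    (ha : Continuous a) (hA : ∀ x, |a x| ≤ A) {n : ℕ} (hn : 1 ≤ n) {σ τ : ℕ → ℝ}
    (hτ0 : τ 0 = 0) (hσlast : σ (n + 1) = L) (hle : ∀ i ≤ n, τ i ≤ σ (i + 1))
    (hστ : ∀ i < n, σ (i + 1) < τ (i + 1)) (hτσ : ∀ i, 1 ≤ i → i < n → τ i < σ (i + 1))
    (hapos : ∀ i < n, ∀ x ∈ Ioo (σ (i + 1)) (τ (i + 1)), 0 < a x)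
    (haneg : ∀ i ≤ n, ∀ x ∈ Ioo (τ i) (σ (i + 1)), a x < 0) :
    ∃ ρ > 0, ∃ lc < 0, ∀ lam < lc, ∀ I : Finset ℕ, ∃ u : ℝ → ℝ, IsNonnegSol L p lam a u ∧
      ∃ M, (∀ x ∈ Icc 0 L, u x ≤ M) ∧
      ∀ i, 1 ≤ i → i ≤ n → (i ∈ I → ∃ x ∈ Ioo (σ i) (τ i), ρ < u x) ∧
        (i ∉ I → ∀ x ∈ Ioo (σ i) (τ i), u x ≤ ρ - 1) := by
  have hA0 : 0 ≤ A := (abs_nonneg _).trans (hA 0)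
  have hτnn : ∀ i ≤ n, 0 ≤ τ i := by
    intro i
    induction i with
    | zero => exact fun _ => hτ0.ge
    | succ i ih =>
      exact fun h => (ih (by omega)).trans ((hle i (by omega)).trans (hστ i (by omega)).le)
  have hσL : ∀ i ≤ n, σ (i + 1) ≤ L := by
    intro i hin
    induction hin using Nat.decreasingInduction with
    | self => exact hσlast.le
    | of_succ k hk ih => exact (hστ k hk).le.trans ((hle (k + 1) hk).trans ih)
  have hτL : ∀ i ≤ n, τ i ≤ L := fun i hi => (hle i hi).trans (hσL i hi)
  have hKO : ∀ i ∈ Finset.Ico 1 n, ∀ᶠ r in Filter.atTop, ∃ η > 0, ∃ α > 0,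
      τ i ≤ (τ i + σ (i + 1)) / 2 - η ∧ (τ i + σ (i + 1)) / 2 + η ≤ σ (i + 1) ∧
      (∀ x ∈ Icc ((τ i + σ (i + 1)) / 2 - η) ((τ i + σ (i + 1)) / 2 + η), a x ≤ -α) ∧
      ∀ M : ℝ, ∀ u v w : ℝ → ℝ, ∀ y : ℝ,
      (∀ x ∈ Icc y (y + η), HasDerivAt u (v x) x) →
      (∀ x ∈ Icc y (y + η), HasDerivAt v (w x) x) →
      (∀ x ∈ Icc y (y + η), 0 ≤ u x → u x ≤ M → α * u x ^ p ≤ w x) →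
      (∀ x ∈ Icc y (y + η), 0 ≤ u x → 0 ≤ w x) →
      u y = r → 0 ≤ v y → ∃ x ∈ Icc y (y + η), M ≤ u x := by
    intro i hi
    rw [Finset.mem_Ico] at hi
    obtain ⟨η, hη, α, hα, h1, h2, h3⟩ := exists_compact_valley (hτσ i hi.1 hi.2)
      ha.continuousOn (haneg i hi.2.le)
    filter_upwards [exists_keller_osserman hp hα hη] with r hr
    exact ⟨η, hη, α, hα, h1, h2, h3, hr⟩
  obtain ⟨r, hKO, hr⟩ := (((Finset.eventually_all _).2 hKO).and
    (Filter.eventually_gt_atTop 0)).exists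
  refine ⟨r + 1, by linarith, -(A * (r + 1) ^ (p - 1) + 1), ?_, fun lam hlam I => ?_⟩
  · have : 0 ≤ A * (r + 1) ^ (p - 1) := by positivity
    linarith
  have hμA : A * (r + 1) ^ (p - 1) < -lam := by linarith
  have hμ : 0 < -lam := lt_of_le_of_lt (by positivity) hμA
  obtain ⟨M, hlarge, hrM⟩ := (((Finset.eventually_all (Finset.range n)).2 fun i hi =>
    exists_no_large_max hp hμ (hστ i (Finset.mem_range.1 hi)) ha.continuousOn
      (hapos i (Finset.mem_range.1 hi))).and (Filter.eventually_gt_atTop (r + 1))).exists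
  have hτ1 : 0 < τ 1 := (hτ0 ▸ hle 0 (by omega)).trans_lt (hστ 0 hn)
  obtain ⟨S, hS, U, V, F, hU0, hU1⟩ := exists_shootingFamily hp hr hrM ha hA hA0 hμA hτ1
    (hτL 1 hn)
  set m : ℕ → ℝ := fun i => if i = 0 then 0 else if i = n then L else (τ i + σ (i + 1)) / 2 with hm
  have hm0 : m 0 = 0 := by simp [hm]
  have hmn : m n = L := by simp [hm, show n ≠ 0 by omega]
  have hmi : ∀ i, 1 ≤ i → i < n → m i = (τ i + σ (i + 1)) / 2 := fun i h1 h2 => by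
    simp [hm, show i ≠ 0 by omega, h2.ne]
  have hmb : ∀ i ≤ n, τ i ≤ m i ∧ m i ≤ σ (i + 1) := by
    intro i hi
    rcases Nat.eq_zero_or_pos i with rfl | h1
    · rw [hm0]
      exact ⟨hτ0.le, hτ0 ▸ hle 0 hi⟩
    rcases hi.eq_or_lt with rfl | h2
    · rw [hmn]
      exact ⟨hτL i le_rfl, hσlast.ge⟩
    · rw [hmi i h1 h2]
      constructor <;> linarith [hτσ i h1 h2]
  obtain ⟨k, rfl⟩ : ∃ k, n = k + 1 := ⟨n - 1, by omega⟩
  have hrestart : ∀ i, 1 ≤ i → i < k + 1 → ∀ s ∈ Icc 0 S, (∀ x ∈ Icc 0 (m i), U s x ≤ M) →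
      U s (m i) = r → 0 < V s (m i) ∧ ∃ x ∈ Icc (m i) (τ (i + 1)), M ≤ U s x := by
    intro i h1 h2 s hs hM heq
    obtain ⟨η, hη, α, hα, b1, b2, ha', hKO⟩ := hKO i (Finset.mem_Ico.2 ⟨h1, h2⟩)
    rw [← hmi i h1 h2] at b1 b2 ha'
    have hmη : 0 ≤ m i - η := (hτnn i h2.le).trans b1
    have hmL : m i + η ≤ L := b2.trans (hσL i h2.le)
    have hV := F.deriv_pos_of_eq hs hα hmη (by linarith) ha' (hKO M) hM heq
    obtain ⟨x, hx, hMx⟩ := F.exists_ge_of_eq hs hα (by linarith) hmL ha' (hKO M) heq hV.le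
    exact ⟨hV, x, ⟨hx.1, hx.2.trans (b2.trans (hστ i h2).le)⟩, hMx⟩
  obtain ⟨c, hc, hz, -⟩ := F.exists_admissiblePath hS hm0 hmn (fun i hi => (hmb i hi.le).2) hστ
    (fun i hi => (hmb (i + 1) hi).1)
    (fun i hi x hx => (haneg i hi.le x ⟨(hmb i hi.le).1.trans_lt hx.1, hx.2⟩).le)
    (fun i hi x hx => (haneg (i + 1) hi x ⟨hx.1, hx.2.trans_le (hmb (i + 1) hi).2⟩).le)
    (fun i hi => hlarge i (Finset.mem_range.2 hi)) hrestart hU0 hU1 I k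
    (Nat.lt_succ_self k)
  obtain ⟨hc0, hbd, -, hpk⟩ := hc.2 0 ⟨le_rfl, zero_le_one⟩
  rw [hmn] at hz hbd
  have hcont : ContinuousOn (U (c 0)) (Icc 0 L) := fun x hx =>
    (F.deriv_fst _ hc0 x hx).continuousAt.continuousWithinAt
  have hf : ∀ x ∈ Icc 0 L, truncField (-lam) p M a x (U (c 0) x) =
      -lam * U (c 0) x - a x * U (c 0) x ^ p := fun x hx =>
    truncField_of_mem (hbd x hx).1 (hbd x hx).2 x
  refine ⟨U (c 0), ⟨V (c 0), fun x => -lam * U (c 0) x - a x * U (c 0) x ^ p,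
    fun x hx => (F.deriv_fst _ hc0 x hx).hasDerivWithinAt,
    fun x hx => ((F.deriv_snd _ hc0 x hx).congr_deriv (hf x hx)).hasDerivWithinAt, ?_,
    fun x hx => (hbd x hx).1, fun x _ => by ring, F.apply_zero _ hc0, hz⟩,
    M, fun x hx => (hbd x hx).2, fun i h1 h2 => ?_⟩
  · exact (continuousOn_const.mul hcont).sub (ha.continuousOn.mul
      (hcont.rpow_const fun x _ => Or.inr (by linarith)))
  · rw [add_sub_cancel_right]
    exact hpk i h1 h2

theorem solutions_for_every_subset_of_peaks
    (L p : ℝ) (hL : 0 < L) (hp : 1 < p)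
    (a : ℝ → ℝ) (ha : ContinuousOn a (Icc 0 L))
    (n : ℕ) (hn : 1 ≤ n) (σ τ : ℕ → ℝ)
    (hτ0 : τ 0 = 0) (hσlast : σ (n + 1) = L)
    (h0σ : τ 0 ≤ σ 1) (hτL : τ n ≤ σ (n + 1))
    (hστ : ∀ i, 1 ≤ i → i ≤ n → σ i < τ i)
    (hτσ : ∀ i, 1 ≤ i → i < n → τ i < σ (i + 1))
    (hapos : ∀ i, 1 ≤ i → i ≤ n → ∀ x ∈ Ioo (σ i) (τ i), 0 < a x)
    (haneg : ∀ i, i ≤ n → ∀ x ∈ Ioo (τ i) (σ (i + 1)), a x < 0)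
    (γ : ℕ → ℝ) (hγ : ∀ i, 1 ≤ i → i ≤ n → 0 < γ i)
    (hG : ∀ i, 1 ≤ i → i ≤ n → ∃ ρi : ℝ → ℝ,
      ContinuousOn ρi (Icc (σ i) (τ i)) ∧
      (∃ ε > (0:ℝ), ∃ c > (0:ℝ), ∀ x ∈ Icc (σ i) (τ i),
        (|x - σ i| < ε ∨ |x - τ i| < ε) → c ≤ |ρi x|) ∧
      (∀ x ∈ Ioo (σ i) (τ i), a x = ρi x * (min (x - σ i) (τ i - x)) ^ γ i)) :
    ∃ ρ > (0:ℝ), ∃ lc < (0:ℝ), ∀ lam < lc,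
      ∀ I : Finset ℕ, I ⊆ Finset.Icc 1 n → I.Nonempty →
        ∃ u : ℝ → ℝ, IsNonnegSol L p lam a u ∧ (∃ x ∈ Icc (0:ℝ) L, u x ≠ 0) ∧
          (∀ i ∈ I, ρ < sSup (u '' Ioo (σ i) (τ i))) ∧
          (∀ i ∈ Finset.Icc 1 n, i ∉ I → sSup (u '' Ioo (σ i) (τ i)) < ρ) := by
  have hle : ∀ i ≤ n, τ i ≤ σ (i + 1) := by
    intro i hi
    rcases Nat.eq_zero_or_pos i with rfl | h1
    · exact h0σ
    rcases hi.eq_or_lt with rfl | h2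
    · exact hτL
    · exact (hτσ i h1 h2).le
  have hτnn : ∀ i ≤ n, 0 ≤ τ i := by
    intro i
    induction i with
    | zero => exact fun _ => hτ0.ge
    | succ i ih =>
      exact fun h => (ih (by omega)).trans ((hle i (by omega)).trans (hστ _ (by omega) h).le)
  have hσL : ∀ i ≤ n, σ (i + 1) ≤ L := by
    intro i hin
    induction hin using Nat.decreasingInduction with
    | self => exact hσlast.le
    | of_succ k hk ih => exact (hστ _ (by omega) hk).le.trans ((hle (k + 1) hk).trans ih)
  have hsub : ∀ i, 1 ≤ i → i ≤ n → Icc (σ i) (τ i) ⊆ Icc 0 L := by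
    intro i h1 h2
    obtain ⟨j, rfl⟩ : ∃ j, i = j + 1 := ⟨i - 1, by omega⟩
    exact Icc_subset_Icc ((hτnn j (by omega)).trans (hle j (by omega)))
      ((hle _ h2).trans (hσL _ h2))
  obtain ⟨A, hA⟩ := isCompact_Icc.exists_bound_of_continuousOn ha
  set a' : ℝ → ℝ := IccExtend hL.le ((Icc 0 L).domRestrict a) with ha'
  have haa : ∀ x ∈ Icc 0 L, a' x = a x := fun x hx => by
    rw [ha', IccExtend_of_mem hL.le _ hx, domRestrict_apply]
  obtain ⟨ρ, hρ, lc, hlc, H⟩ := exists_solutions_of_continuous (a := a') (σ := σ) (τ := τ) (A := A)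
    hp ha.domRestrict.Icc_extend' (fun x => hA _ (Subtype.coe_prop _)) hn hτ0 hσlast
    hle (fun i hi => hστ _ (by omega) hi) hτσ
    (fun i hi x hx => by
      rw [haa x (hsub _ (by omega) hi (Ioo_subset_Icc_self hx))]
      exact hapos _ (by omega) hi x hx)
    (fun i hi x hx => by
      rw [haa x ⟨(hτnn i hi).trans hx.1.le, hx.2.le.trans (hσL i hi)⟩]
      exact haneg i hi x hx)
  refine ⟨ρ, hρ, lc, hlc, fun lam hlam I hI hne => ?_⟩
  obtain ⟨u, ⟨u', u'', h1, h2, h3, h4, h5, h6⟩, M, hM, hpk⟩ := H lam hlam I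
  refine ⟨u, ⟨u', u'', h1, h2, h3, h4,
    fun x hx => haa x (Ioo_subset_Icc_self hx) ▸ h5 x hx, h6⟩, ?_, fun i hi => ?_,
    fun i hi hiI => ?_⟩
  · obtain ⟨i, hi⟩ := hne
    obtain ⟨hi1, hi2⟩ := Finset.mem_Icc.1 (hI hi)
    obtain ⟨x, hx, hux⟩ := (hpk i hi1 hi2).1 hi
    exact ⟨x, hsub i hi1 hi2 (Ioo_subset_Icc_self hx), (hρ.trans hux).ne'⟩
  · obtain ⟨hi1, hi2⟩ := Finset.mem_Icc.1 (hI hi)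
    obtain ⟨x, hx, hux⟩ := (hpk i hi1 hi2).1 hi
    refine hux.trans_le (le_csSup ⟨M, ?_⟩ (mem_image_of_mem u hx))
    rintro _ ⟨y, hy, rfl⟩
    exact hM y (hsub i hi1 hi2 (Ioo_subset_Icc_self hy))
  · obtain ⟨hi1, hi2⟩ := Finset.mem_Icc.1 hi
    refine (csSup_le ((nonempty_Ioo.2 (hστ i hi1 hi2)).image u) ?_).trans_lt (sub_one_lt ρ)
    rintro _ ⟨y, hy, rfl⟩
    exact (hpk i hi1 hi2).2 hiI y hy
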